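/- arXiv:1802.07186 — 2 statements merged into one kernel-verified Lean document; each statement's English description precedes it below -/
import Mathlib

section
/- A priori energy differential inequality for the symmetric hyperbolic system: let n ≥ 1 and s ≥ 1 be integers, γ > 1, r̄ > 0 and T > 0. There exists a constant c > 0, depending only on n, s and γ, with the following property. Let r : [0,T] × ℝⁿ → ℝ and u : [0,T] × ℝⁿ → ℝⁿ be smooth and satisfy pointwise on [0,T] × ℝⁿ the equations ∂_t r + u·∇_x r + ((γ−1)/2) r div_x u = 0 and ∂_t u + (u·∇_x)u + r ∇_x r = 0. Assume that for every multi-index α with |α| ≤ s+1 the functions ∂^α_x(r − r̄) and ∂^α_x u are bounded on [0,T] × ℝⁿ, square-integrable in x for each t, and depend continuously on t as maps into L²(ℝⁿ). Define E(t) = Σ_{|α| ≤ s} ∫_{ℝⁿ} ( |∂^α_x (r − r̄)(t,x)|² + ((γ−1)/2) |∂^α_x u(t,x)|² ) dx. Then E is differentiable on [0,T] and for every t ∈ [0,T]: E'(t) ≤ c ( ‖∇_x u(t,·)‖_{L^∞(ℝⁿ)} + ‖∇_x r(t,·)‖_{L^∞(ℝⁿ)} ) E(t). -/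
open MeasureTheory Set Finset

/-- Partial derivative in the `i`-th coordinate direction. -/
noncomputable def pd {n : ℕ} (i : Fin n) (f : (Fin n → ℝ) → ℝ) : (Fin n → ℝ) → ℝ :=
  fun x => fderiv ℝ f x (Pi.single i 1)

/-- Classical partial derivative `∂^α` for a multi-index `α`. -/
noncomputable def mderiv {n : ℕ} (α : Fin n → ℕ) (f : (Fin n → ℝ) → ℝ) : (Fin n → ℝ) → ℝ :=
  (List.ofFn fun i : Fin n => (pd i)^[α i]).foldr (· ∘ ·) id f

/-- The finite set of multi-indices `α` with `|α| ≤ s`. -/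
def multiIndices (n s : ℕ) : Finset (Fin n → ℕ) :=
  (Fintype.piFinset fun _ : Fin n => Finset.range (s + 1)).filter fun α => ∑ i, α i ≤ s

/-- The energy functional
`E(t) = Σ_{|α| ≤ s} ∫ (|∂^α(r − r̄)|² + ((γ−1)/2)|∂^α u|²) dx`. -/
noncomputable def En (n s : ℕ) (γ rbar : ℝ) (r : ℝ → (Fin n → ℝ) → ℝ)
    (u : ℝ → (Fin n → ℝ) → Fin n → ℝ) (t : ℝ) : ℝ :=
  ∑ α ∈ multiIndices n s,
    ∫ x, (mderiv α (fun y => r t y - rbar) x ^ 2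
      + (γ - 1) / 2 * ∑ i, mderiv α (fun y => u t y i) x ^ 2)



/-! ### Part A: calculus of iterated partial derivatives -/

/-- Iterated partial derivative along a word of directions. -/
noncomputable def Dw {n : ℕ} : List (Fin n) → ((Fin n → ℝ) → ℝ) → ((Fin n → ℝ) → ℝ)
  | [], f => f
  | k :: w, f => pd k (Dw w f)

/-- Smoothness. -/
abbrev Sm {E : Type*} [NormedAddCommGroup E] [NormedSpace ℝ E] (f : E → ℝ) : Prop :=
  ContDiff ℝ ((⊤ : ℕ∞) : WithTop ℕ∞) f

lemma Sm.dir {E : Type*} [NormedAddCommGroup E] [NormedSpace ℝ E] {f : E → ℝ} (hf : Sm f) (v : E) :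
    Sm (fun x => fderiv ℝ f x v) := by
  have h : ContDiff ℝ ((⊤ : ℕ∞) : WithTop ℕ∞) (fderiv ℝ f) :=
    hf.fderiv_right (by exact_mod_cast le_refl _)
  exact h.clm_apply contDiff_const

lemma Sm.diff {E : Type*} [NormedAddCommGroup E] [NormedSpace ℝ E] {f : E → ℝ} (hf : Sm f) :
    Differentiable ℝ f := hf.differentiable (by simp)

lemma Sm.dir_comm {E : Type*} [NormedAddCommGroup E] [NormedSpace ℝ E] {f : E → ℝ} (hf : Sm f)
    (v w : E) (x : E) :
    fderiv ℝ (fun y => fderiv ℝ f y v) x w = fderiv ℝ (fun y => fderiv ℝ f y w) x v := by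
  have h : ContDiff ℝ ((⊤ : ℕ∞) : WithTop ℕ∞) (fderiv ℝ f) :=
    hf.fderiv_right (by exact_mod_cast le_refl _)
  have hd : DifferentiableAt ℝ (fderiv ℝ f) x := h.differentiable (by simp) x
  have key : ∀ a b : E, fderiv ℝ (fun y => fderiv ℝ f y a) x b = fderiv ℝ (fderiv ℝ f) x b a := by
    intro a b
    rw [fderiv_clm_apply hd (differentiableAt_const a)]
    simp
  rw [key, key]
  have hs : IsSymmSndFDerivAt ℝ f x :=
    (hf.contDiffAt).isSymmSndFDerivAt (by
      have h2 : ((2 : ℕ∞) : WithTop ℕ∞) ≤ ((⊤ : ℕ∞) : WithTop ℕ∞) := WithTop.coe_le_coe.2 le_top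
      simpa using h2)
  exact hs.eq w v

section
variable {n : ℕ}

lemma Sm.pd {f : (Fin n → ℝ) → ℝ} (hf : Sm f) (k : Fin n) : Sm (pd k f) := Sm.dir hf _

lemma Sm.Dw {f : (Fin n → ℝ) → ℝ} (hf : Sm f) (w : List (Fin n)) : Sm (Dw w f) := by
  induction w with
  | nil => exact hf
  | cons k w ih => exact ih.pd k

lemma pd_comm {f : (Fin n → ℝ) → ℝ} (hf : Sm f) (i j : Fin n) :
    pd i (pd j f) = pd j (pd i f) := by
  funext x
  exact Sm.dir_comm hf _ _ x

lemma Dw_append (a b : List (Fin n)) (f : (Fin n → ℝ) → ℝ) :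
    Dw (a ++ b) f = Dw a (Dw b f) := by
  induction a with
  | nil => rfl
  | cons k a ih => simp [Dw, ih]

lemma Dw_perm {f : (Fin n → ℝ) → ℝ} (hf : Sm f) {a b : List (Fin n)} (h : a.Perm b) :
    Dw a f = Dw b f := by
  induction h with
  | nil => rfl
  | cons x _ ih => simp [Dw, ih]
  | swap x y l => exact pd_comm (hf.Dw l) _ _
  | trans _ _ h1 h2 => exact h1.trans h2

lemma Dw_pd {f : (Fin n → ℝ) → ℝ} (hf : Sm f) (w : List (Fin n)) (k : Fin n) :
    Dw w (pd k f) = pd k (Dw w f) := by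
  have h1 : Dw w (pd k f) = Dw (w ++ [k]) f := by rw [Dw_append]; rfl
  rw [h1]
  exact Dw_perm hf (List.perm_append_singleton k w)

lemma pd_add {f g : (Fin n → ℝ) → ℝ} (hf : Sm f) (hg : Sm g) (k : Fin n) :
    pd k (fun x => f x + g x) = fun x => pd k f x + pd k g x := by
  funext x
  simp only [pd]
  rw [fderiv_fun_add (hf.diff x) (hg.diff x)]; rfl

lemma pd_mul {f g : (Fin n → ℝ) → ℝ} (hf : Sm f) (hg : Sm g) (k : Fin n) :
    pd k (fun x => f x * g x) = fun x => f x * pd k g x + pd k f x * g x := by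
  funext x
  simp only [pd]
  rw [fderiv_fun_mul (hf.diff x) (hg.diff x)]
  simp; ring

lemma pd_const_mul {f : (Fin n → ℝ) → ℝ} (hf : Sm f) (c : ℝ) (k : Fin n) :
    pd k (fun x => c * f x) = fun x => c * pd k f x := by
  funext x
  simp only [pd]
  rw [fderiv_const_mul (hf.diff x)]; rfl

lemma pd_sub_const (f : (Fin n → ℝ) → ℝ) (c : ℝ) (k : Fin n) :
    pd k (fun x => f x - c) = pd k f := by
  funext x
  simp only [pd, fderiv_sub_const]

lemma Dw_add {f g : (Fin n → ℝ) → ℝ} (hf : Sm f) (hg : Sm g) (w : List (Fin n)) :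
    Dw w (fun x => f x + g x) = fun x => Dw w f x + Dw w g x := by
  induction w with
  | nil => rfl
  | cons k w ih => simp only [Dw, ih]; exact pd_add (hf.Dw w) (hg.Dw w) k

lemma Dw_const_mul {f : (Fin n → ℝ) → ℝ} (hf : Sm f) (c : ℝ) (w : List (Fin n)) :
    Dw w (fun x => c * f x) = fun x => c * Dw w f x := by
  induction w with
  | nil => rfl
  | cons k w ih => simp only [Dw, ih]; exact pd_const_mul (hf.Dw w) c k

lemma Dw_zero (w : List (Fin n)) :
    Dw w (fun _ : Fin n → ℝ => (0 : ℝ)) = fun _ => 0 := by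
  induction w with
  | nil => rfl
  | cons k w ih => simp only [Dw, ih]; funext x; simp [pd]

lemma Sm.fsum {ι : Type*} {S : Finset ι} {f : ι → (Fin n → ℝ) → ℝ} (hf : ∀ i, Sm (f i)) :
    Sm (fun x => ∑ i ∈ S, f i x) := ContDiff.sum fun i _ => hf i

lemma Dw_sum {ι : Type*} (S : Finset ι) {f : ι → (Fin n → ℝ) → ℝ} (hf : ∀ i, Sm (f i))
    (w : List (Fin n)) :
    Dw w (fun x => ∑ i ∈ S, f i x) = fun x => ∑ i ∈ S, Dw w (f i) x := by
  classical
  induction S using Finset.induction_on with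
  | empty => simp [Dw_zero]
  | insert a S ha ih =>
    simp only [Finset.sum_insert ha]
    rw [Dw_add (hf a) (Sm.fsum hf), ih]

lemma pd_iterate_eq (k : Fin n) (m : ℕ) (f : (Fin n → ℝ) → ℝ) :
    (pd k)^[m] f = Dw (List.replicate m k) f := by
  induction m with
  | zero => rfl
  | succ m ih => rw [Function.iterate_succ_apply', ih]; rfl

/-- The sorted word of a multi-index. -/
def wordOf (α : Fin n → ℕ) : List (Fin n) :=
  (List.ofFn fun i : Fin n => List.replicate (α i) i).flatten

lemma foldr_eq_Dw (α : Fin n → ℕ) (L : List (Fin n)) (f : (Fin n → ℝ) → ℝ) :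
    (L.map fun i : Fin n => (pd i)^[α i]).foldr (· ∘ ·) id f
      = Dw ((L.map fun i : Fin n => List.replicate (α i) i).flatten) f := by
  induction L with
  | nil => rfl
  | cons k L ih => simp [ih, Dw_append, pd_iterate_eq]

lemma mderiv_eq (α : Fin n → ℕ) (f : (Fin n → ℝ) → ℝ) : mderiv α f = Dw (wordOf α) f := by
  unfold mderiv wordOf
  rw [List.ofFn_eq_map, List.ofFn_eq_map]
  exact foldr_eq_Dw α _ f

lemma count_wordOf (α : Fin n → ℕ) (i : Fin n) : (wordOf α).count i = α i := by
  unfold wordOf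
  rw [List.count_flatten, List.map_ofFn, List.sum_ofFn]
  simp [List.count_replicate]

lemma length_wordOf (α : Fin n → ℕ) : (wordOf α).length = ∑ i, α i := by
  unfold wordOf
  rw [List.length_flatten, List.map_ofFn, List.sum_ofFn]
  simp

lemma mem_multiIndices {m : ℕ} {α : Fin n → ℕ} : α ∈ multiIndices n m ↔ ∑ i, α i ≤ m := by
  unfold multiIndices
  simp only [Finset.mem_filter, Fintype.mem_piFinset, Finset.mem_range, and_iff_right_iff_imp]
  intro h i
  have : α i ≤ ∑ i, α i := Finset.single_le_sum (fun _ _ => Nat.zero_le _) (Finset.mem_univ i)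
  omega

lemma exists_multi (w : List (Fin n)) : ∃ α : Fin n → ℕ, ∑ i, α i = w.length ∧
    ∀ f : (Fin n → ℝ) → ℝ, Sm f → mderiv α f = Dw w f := by
  have hp : (wordOf fun i => w.count i).Perm w := by
    rw [List.perm_iff_count]; intro i; rw [count_wordOf]
  refine ⟨fun i => w.count i, ?_, fun f hf => ?_⟩
  · rw [← length_wordOf, hp.length_eq]
  · rw [mderiv_eq]; exact Dw_perm hf hp

/-- Leibniz rule in commutator form. -/
lemma leibniz (w : List (Fin n)) : ∃ L : List (List (Fin n) × Fin n × List (Fin n)),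
    (∀ p ∈ L, p.1.length + p.2.2.length + 1 = w.length) ∧
    ∀ f g : (Fin n → ℝ) → ℝ, Sm f → Sm g →
      Dw w (fun x => f x * g x) = fun x => f x * Dw w g x
        + (L.map fun p => Dw p.1 (pd p.2.1 f) x * Dw p.2.2 g x).sum := by
  induction w with
  | nil => exact ⟨[], by simp, by simp [Dw]⟩
  | cons k w ih =>
    obtain ⟨L, hL, h⟩ := ih
    refine ⟨L.map (fun p => (p.1, p.2.1, k :: p.2.2)) ++ L.map (fun p => (k :: p.1, p.2.1, p.2.2))
      ++ [([], k, w)], ?_, ?_⟩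
    · intro p hp
      simp only [List.mem_append, List.mem_map, List.mem_singleton] at hp
      rcases hp with (⟨q, hq, rfl⟩ | ⟨q, hq, rfl⟩) | rfl
      · have := hL q hq; simp; omega
      · have := hL q hq; simp; omega
      · simp
    · intro f g hf hg
      have hS : ∀ L : List (List (Fin n) × Fin n × List (Fin n)),
          Sm (fun x => (L.map fun p => Dw p.1 (pd p.2.1 f) x * Dw p.2.2 g x).sum) ∧
          pd k (fun x => (L.map fun p => Dw p.1 (pd p.2.1 f) x * Dw p.2.2 g x).sum) =
          fun x => (L.map fun p => Dw p.1 (pd p.2.1 f) x * Dw (k :: p.2.2) g x).sum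
            + (L.map fun p => Dw (k :: p.1) (pd p.2.1 f) x * Dw p.2.2 g x).sum := by
        intro L
        induction L with
        | nil => 
          refine ⟨by simpa using contDiff_const, ?_⟩
          funext x; simp [pd]
        | cons q L ih2 =>
          have hq : Sm (fun x => Dw q.1 (pd q.2.1 f) x * Dw q.2.2 g x) :=
            ((hf.pd _).Dw _).mul (hg.Dw _)
          refine ⟨by simpa using hq.add ih2.1, ?_⟩
          simp only [List.map_cons, List.sum_cons]
          rw [pd_add hq ih2.1, ih2.2, pd_mul ((hf.pd _).Dw _) (hg.Dw _)]
          funext x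
          simp only [Dw]; ring
      simp only [Dw, h f g hf hg]
      rw [pd_add (hf.mul (hg.Dw w)) (hS L).1, (hS L).2, pd_mul hf (hg.Dw w)]
      funext x
      simp [Dw, Function.comp_def]
      ring

end


/-! ### Part B: interpolation inequalities -/

section
variable {n : ℕ}

/-- Continuous, bounded, square integrable functions. -/
def BL (f : (Fin n → ℝ) → ℝ) : Prop :=
  Continuous f ∧ (∃ C, 0 ≤ C ∧ ∀ x, |f x| ≤ C) ∧ Integrable (fun x => f x ^ 2)

lemma bdd_int {φ F : (Fin n → ℝ) → ℝ} (hφ : Continuous φ) {C : ℝ} (hC : ∀ x, |φ x| ≤ C)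
    (hF : Integrable F) : Integrable (fun x => φ x * F x) :=
  hF.bdd_mul hφ.aestronglyMeasurable (Filter.Eventually.of_forall hC)

lemma BL.mul_int {f g : (Fin n → ℝ) → ℝ} (hf : BL f) (hg : BL g) :
    Integrable (fun x => f x * g x) := by
  refine (hf.2.2.add hg.2.2).mono' (hf.1.mul hg.1).aestronglyMeasurable
    (Filter.Eventually.of_forall fun x => ?_)
  simp only [Pi.add_apply, Real.norm_eq_abs, abs_mul]
  nlinarith [sq_nonneg (|f x| - |g x|), sq_abs (f x), sq_abs (g x), sq_nonneg (f x),
    sq_nonneg (g x)]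

lemma BL.abs {f : (Fin n → ℝ) → ℝ} (hf : BL f) : BL (fun x => |f x|) := by
  refine ⟨hf.1.abs, ?_, ?_⟩
  · obtain ⟨C, h0, hC⟩ := hf.2.1
    exact ⟨C, h0, by simpa using hC⟩
  · simpa using hf.2.2

lemma BL.bmul {φ f : (Fin n → ℝ) → ℝ} (hφ : Continuous φ) {C : ℝ} (hC : ∀ x, |φ x| ≤ C)
    (hf : BL f) : BL (fun x => φ x * f x) := by
  obtain ⟨K, h0, hK⟩ := hf.2.1
  have hC0 : 0 ≤ C := (abs_nonneg _).trans (hC 0)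
  refine ⟨hφ.mul hf.1, ⟨C * K, by positivity, fun x => ?_⟩, ?_⟩
  · rw [abs_mul]; exact mul_le_mul (hC x) (hK x) (abs_nonneg _) hC0
  · have : (fun x => (φ x * f x) ^ 2) = fun x => (φ x ^ 2) * (f x ^ 2) := by funext x; ring
    rw [this]
    refine bdd_int (C := C ^ 2) (hφ.pow 2) (fun x => ?_) hf.2.2
    rw [abs_pow]; exact pow_le_pow_left₀ (abs_nonneg _) (hC x) 2

lemma BL.mul {f g : (Fin n → ℝ) → ℝ} (hf : BL f) (hg : BL g) : BL (fun x => f x * g x) := by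
  obtain ⟨C, _, hC⟩ := hf.2.1
  exact BL.bmul hf.1 hC hg

lemma BL.cmul {f : (Fin n → ℝ) → ℝ} (c : ℝ) (hf : BL f) : BL (fun x => c * f x) :=
  BL.bmul (φ := fun _ => c) continuous_const (C := |c|) (fun _ => le_refl _) hf

lemma BL.add {f g : (Fin n → ℝ) → ℝ} (hf : BL f) (hg : BL g) : BL (fun x => f x + g x) := by
  obtain ⟨C, hC0, hC⟩ := hf.2.1
  obtain ⟨K, hK0, hK⟩ := hg.2.1
  refine ⟨hf.1.add hg.1, ⟨C + K, by positivity, fun x => ?_⟩, ?_⟩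
  · exact (abs_add_le _ _).trans (add_le_add (hC x) (hK x))
  · have : (fun x => (f x + g x) ^ 2) = fun x => (f x ^ 2 + 2 * (f x * g x)) + g x ^ 2 := by
      funext x; ring
    rw [this]
    exact (hf.2.2.add ((hf.mul_int hg).const_mul 2)).add hg.2.2

lemma BL.rpow_int {f : (Fin n → ℝ) → ℝ} (hf : BL f) {p : ℝ} (hp : 2 ≤ p) :
    Integrable (fun x => |f x| ^ p) := by
  obtain ⟨C, hC0, hC⟩ := hf.2.1
  have h1 : (fun x => |f x| ^ p) = fun x => |f x| ^ (p - 2) * f x ^ 2 := by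
    funext x
    rw [← sq_abs, ← Real.rpow_natCast, ← Real.rpow_add_of_nonneg (abs_nonneg _) (by linarith)
      (by norm_num)]
    congr 1; push_cast; ring
  rw [h1]
  refine bdd_int (C := C ^ (p - 2)) ?_ (fun x => ?_) hf.2.2
  · exact hf.1.abs.rpow_const (fun x => Or.inr (by linarith))
  · rw [abs_of_nonneg (by positivity)]
    exact Real.rpow_le_rpow (abs_nonneg _) (hC x) (by linarith)

lemma hasDerivAt_mul_abs_rpow (y : ℝ) {q : ℝ} (hq : 0 < q) :
    HasDerivAt (fun z : ℝ => z * |z| ^ q) ((q + 1) * |y| ^ q) y := by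
  rcases eq_or_ne y 0 with rfl | hy
  · rw [hasDerivAt_iff_tendsto_slope]
    have hc : Continuous (fun z : ℝ => |z| ^ q) :=
      continuous_abs.rpow_const (fun x => Or.inr hq.le)
    have h0 : (q + 1) * |(0 : ℝ)| ^ q = |(0 : ℝ)| ^ q := by
      simp [Real.zero_rpow hq.ne']
    rw [h0]
    refine ((hc.tendsto 0).mono_left nhdsWithin_le_nhds).congr' ?_
    filter_upwards [self_mem_nhdsWithin] with z hz
    simp only [slope_def_field, zero_mul, sub_zero]
    have hz' : z ≠ 0 := hz
    field_simp
  · have habs : |y| ≠ 0 := abs_ne_zero.2 hy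
    have h1 : HasDerivAt (fun z : ℝ => |z|) (SignType.sign y : ℝ) y := hasDerivAt_abs hy
    have h2 := (hasDerivAt_id y).mul (h1.rpow_const (p := q) (Or.inl habs))
    refine h2.congr_deriv ?_
    have h3 : |y| ^ q = |y| ^ (q - 1) * |y| := by
      rw [Real.rpow_sub_one habs]; field_simp
    have h4 : y * (SignType.sign y : ℝ) = |y| := by
      rw [mul_comm]; exact sign_mul_self y
    simp only [id]
    rw [h3, ← h4]; ring

/-- Integration by parts for the interpolation inequality. -/
lemma gn_ibp {h : (Fin n → ℝ) → ℝ} (hs : Sm h) (k : Fin n) (h0 : BL h) (h1 : BL (pd k h))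
    (h2 : BL (pd k (pd k h))) {p : ℝ} (hp : 2 < p) :
    ∫ x, |pd k h x| ^ p ≤
      ∫ x, (p - 1) * (|h x| * |pd k h x| ^ (p - 2) * |pd k (pd k h) x|) := by
  set g := pd k h with hg
  have hgs : Sm g := hs.pd k
  obtain ⟨C, hC0, hC⟩ := h1.2.1
  have hcont : Continuous (fun x => |g x| ^ (p - 2)) :=
    h1.1.abs.rpow_const (fun x => Or.inr (by linarith))
  have hbd : ∀ x, |(|g x| ^ (p - 2))| ≤ C ^ (p - 2) := fun x => by
    rw [abs_of_nonneg (by positivity)]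
    exact Real.rpow_le_rpow (abs_nonneg _) (hC x) (by linarith)
  have hfd : ∀ x, HasFDerivAt (fun y => g y * |g y| ^ (p - 2))
      (((p - 2 + 1) * |g x| ^ (p - 2)) • fderiv ℝ g x) x := fun x =>
    (hasDerivAt_mul_abs_rpow (g x) (q := p - 2) (by linarith)).comp_hasFDerivAt x
      (hgs.diff x).hasFDerivAt
  have hfd' : ∀ x, fderiv ℝ (fun y => g y * |g y| ^ (p - 2)) x (Pi.single k 1)
      = (p - 1) * (|g x| ^ (p - 2) * pd k g x) := fun x => by
    rw [(hfd x).fderiv]; simp [pd]; ring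
  have hgg : ∀ x, fderiv ℝ h x (Pi.single k 1) * (g x * |g x| ^ (p - 2)) = |g x| ^ p := fun x => by
    have : fderiv ℝ h x (Pi.single k 1) = g x := rfl
    rw [this, ← mul_assoc, ← sq, ← sq_abs, ← Real.rpow_natCast,
      ← Real.rpow_add_of_nonneg (abs_nonneg _) (by norm_num) (by linarith)]
    congr 1; push_cast; ring
  have ibp := integral_mul_fderiv_eq_neg_fderiv_mul_of_integrable (μ := volume) (f := h)
    (g := fun y => g y * |g y| ^ (p - 2)) (v := Pi.single k 1)
    (by simp only [hgg]; exact h1.rpow_int hp.le)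
    (by
      simp only [hfd']
      have := ((BL.bmul hcont hbd (h0.mul h2)).cmul (p - 1))
      have h3 := (bdd_int hcont hbd (h0.mul_int h2)).const_mul (p - 1)
      refine h3.congr (Filter.Eventually.of_forall fun x => ?_)
      simp only; ring)
    (by
      have h3 := (bdd_int hcont hbd (h0.mul_int h1))
      refine h3.congr (Filter.Eventually.of_forall fun x => ?_)
      simp only; ring)
    (fun x _ => hs.diff x) (fun x _ => (hfd x).differentiableAt)
  simp only [hgg, hfd'] at ibp
  have h5 : ∫ x, |g x| ^ p = ∫ x, -(h x * ((p - 1) * (|g x| ^ (p - 2) * pd k g x))) := by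
    rw [integral_neg, ibp, neg_neg]
  rw [h5]
  have h3 := (bdd_int hcont hbd (h0.mul_int h2)).const_mul (p - 1)
  have h4 := (bdd_int hcont hbd (h0.abs.mul_int h2.abs)).const_mul (p - 1)
  refine integral_mono ?_ ?_ ?_
  · refine h3.neg.congr (Filter.Eventually.of_forall fun x => ?_)
    simp only [Pi.neg_apply]; ring
  · refine h4.congr (Filter.Eventually.of_forall fun x => ?_)
    simp only; ring
  · intro x
    refine (le_abs_self _).trans (le_of_eq ?_)
    rw [abs_neg, abs_mul, abs_mul, abs_mul, abs_of_nonneg (by linarith : 0 ≤ p - 1),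
      abs_of_nonneg (by positivity : 0 ≤ |g x| ^ (p - 2))]
    ring

/-- Weighted three-term Young inequality with small parameters. -/
lemma young3 {w₁ w₂ w₃ : ℝ} (h1 : 0 ≤ w₁) (h2 : 0 ≤ w₂) (h3 : 0 < w₃) (hw : w₁ + w₂ + w₃ = 1)
    {K₀ ε δ : ℝ} (hK : 0 < K₀) (hε : 0 < ε) (hδ : 0 < δ) :
    ∃ K : ℝ, 0 < K ∧ ∀ a b c : ℝ, 0 ≤ a → 0 ≤ b → 0 ≤ c →
      K₀ * (a ^ w₁ * b ^ w₂ * c ^ w₃) ≤ ε * a + δ * b + K * c := by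
  refine ⟨(K₀ / (ε ^ w₁ * δ ^ w₂)) ^ (1 / w₃), by positivity, fun a b c ha hb hc => ?_⟩
  set K := (K₀ / (ε ^ w₁ * δ ^ w₂)) ^ (1 / w₃) with hKdef
  have hKpos : 0 < K := by positivity
  have hKw : K ^ w₃ = K₀ / (ε ^ w₁ * δ ^ w₂) := by
    rw [hKdef, ← Real.rpow_mul (by positivity), one_div, inv_mul_cancel₀ h3.ne', Real.rpow_one]
  have := Real.geom_mean_le_arith_mean3_weighted h1 h2 h3.le (by positivity : 0 ≤ ε * a)
    (by positivity : 0 ≤ δ * b) (by positivity : 0 ≤ K * c) hw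
  rw [Real.mul_rpow hε.le ha, Real.mul_rpow hδ.le hb, Real.mul_rpow hKpos.le hc, hKw] at this
  have e1 : ε ^ w₁ * a ^ w₁ * (δ ^ w₂ * b ^ w₂) * (K₀ / (ε ^ w₁ * δ ^ w₂) * c ^ w₃)
      = K₀ * (a ^ w₁ * b ^ w₂ * c ^ w₃) := by
    have : 0 < ε ^ w₁ := by positivity
    have : 0 < δ ^ w₂ := by positivity
    field_simp
  rw [e1] at this
  have l1 : w₁ * (ε * a) ≤ 1 * (ε * a) := mul_le_mul_of_nonneg_right (by linarith) (by positivity)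
  have l2 : w₂ * (δ * b) ≤ 1 * (δ * b) := mul_le_mul_of_nonneg_right (by linarith) (by positivity)
  have l3 : w₃ * (K * c) ≤ 1 * (K * c) := mul_le_mul_of_nonneg_right (by linarith) (by positivity)
  linarith

end


section
variable {n : ℕ}

/-- Smooth functions whose derivatives up to order `m` are bounded and square integrable. -/
def Cls (m : ℕ) (f : (Fin n → ℝ) → ℝ) : Prop :=
  Sm f ∧ ∀ w : List (Fin n), w.length ≤ m → BL (Dw w f)

lemma gn_exp {m j : ℕ} (hj : 1 ≤ j) (hjm : j ≤ m) : (2 : ℝ) ≤ 2 * m / j := by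
  have h1 : (0 : ℝ) < j := by exact_mod_cast hj
  have h2 : (j : ℝ) ≤ m := by exact_mod_cast hjm
  rw [le_div_iff₀ h1]; linarith

lemma gn_step {m j : ℕ} (hj : 1 ≤ j) (hjm : j < m) {ε : ℝ} (hε : 0 < ε) :
    ∃ K : ℝ, 0 < K ∧ ∀ f : (Fin n → ℝ) → ℝ, Cls m f → (∀ x, |f x| ≤ 1) →
      ∀ (k : Fin n) (w : List (Fin n)), w.length + 1 = j →
      ∫ x, |Dw (k :: w) f x| ^ (2 * m / j : ℝ) ≤
        ε * (if j = 1 then 0 else ∫ x, |Dw w f x| ^ (2 * m / (j - 1 : ℕ) : ℝ))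
        + K * ∫ x, |Dw (k :: k :: w) f x| ^ (2 * m / (j + 1 : ℕ) : ℝ) := by
  have hj0 : (0 : ℝ) < j := by exact_mod_cast hj
  have hj1 : (1 : ℝ) ≤ j := by exact_mod_cast hj
  have hjm' : (j : ℝ) < m := by exact_mod_cast hjm
  have hm0 : (0 : ℝ) < m := by linarith
  have hp : (2 : ℝ) < 2 * m / j := by rw [lt_div_iff₀ hj0]; linarith
  obtain ⟨K, hK, hY⟩ := young3 (w₁ := ((j : ℝ) - 1) / (2 * m)) (w₂ := 1 - j / m)
    (w₃ := ((j : ℝ) + 1) / (2 * m)) (K₀ := 2 * m / j - 1) (ε := ε / 2) (δ := 1 / 2)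
    (by apply div_nonneg <;> linarith)
    (by rw [sub_nonneg, div_le_one hm0]; linarith) (by positivity) (by field_simp; ring)
    (by linarith) (by linarith) (by norm_num)
  refine ⟨2 * K, by linarith, fun f hf hf1 k w hw => ?_⟩
  have b0 : BL (Dw w f) := hf.2 w (by omega)
  have b1 : BL (Dw (k :: w) f) := hf.2 (k :: w) (by simp; omega)
  have b2 : BL (Dw (k :: k :: w) f) := hf.2 (k :: k :: w) (by simp; omega)
  have key := gn_ibp (hf.1.Dw w) k b0 b1 b2 hp
  have i1 : Integrable (fun x => |Dw (k :: w) f x| ^ (2 * m / j : ℝ)) := b1.rpow_int hp.le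
  have i2 : Integrable (fun x => |Dw (k :: k :: w) f x| ^ (2 * m / (j + 1 : ℕ) : ℝ)) :=
    b2.rpow_int (gn_exp (by omega) (by omega))
  have i0 : Integrable (fun x => if j = 1 then (0 : ℝ) else
      |Dw w f x| ^ (2 * m / (j - 1 : ℕ) : ℝ)) := by
    by_cases h : j = 1
    · simp [h]
    · simp only [h, if_false]
      exact b0.rpow_int (gn_exp (by omega) (by omega))
  have hpt : ∀ x, (2 * m / j - 1 : ℝ) * (|Dw w f x| * |pd k (Dw w f) x| ^ (2 * m / j - 2 : ℝ)
      * |pd k (pd k (Dw w f)) x|) ≤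
      (ε / 2 * (if j = 1 then (0 : ℝ) else |Dw w f x| ^ (2 * m / (j - 1 : ℕ) : ℝ))
        + 1 / 2 * |Dw (k :: w) f x| ^ (2 * m / j : ℝ))
        + K * |Dw (k :: k :: w) f x| ^ (2 * m / (j + 1 : ℕ) : ℝ) := by
    intro x
    have ha : 0 ≤ (if j = 1 then (0 : ℝ) else |Dw w f x| ^ (2 * m / (j - 1 : ℕ) : ℝ)) := by
      split_ifs
      · exact le_refl _
      · positivity
    refine le_trans ?_ (hY _ _ _ ha (by positivity) (by positivity))
    refine mul_le_mul_of_nonneg_left ?_ (by linarith)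
    have e2 : (|Dw (k :: w) f x| ^ (2 * m / j : ℝ)) ^ (1 - j / m : ℝ)
        = |pd k (Dw w f) x| ^ (2 * m / j - 2 : ℝ) := by
      rw [← Real.rpow_mul (abs_nonneg _)]
      simp only [Dw]
      congr 1; field_simp
    have e3 : (|Dw (k :: k :: w) f x| ^ (2 * m / (j + 1 : ℕ) : ℝ)) ^ ((j + 1) / (2 * m) : ℝ)
        = |pd k (pd k (Dw w f)) x| := by
      rw [← Real.rpow_mul (abs_nonneg _)]
      simp only [Dw]
      push_cast
      have : (2 * m / (j + 1) : ℝ) * ((j + 1) / (2 * m)) = 1 := by field_simp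
      rw [this, Real.rpow_one]
    rw [e2, e3]
    refine mul_le_mul_of_nonneg_right (mul_le_mul_of_nonneg_right ?_ (by positivity))
      (by positivity)
    by_cases h : j = 1
    · subst h
      have : w = [] := List.length_eq_zero_iff.1 (by omega)
      subst this
      simpa [Dw] using hf1 x
    · simp only [h, if_false]
      rw [← Real.rpow_mul (abs_nonneg _)]
      have hj2 : (0 : ℝ) < (j : ℝ) - 1 := by
        have : (2 : ℝ) ≤ j := by exact_mod_cast (by omega : 2 ≤ j)
        linarith
      rw [Nat.cast_sub hj]
      have : (2 * m / (j - (1 : ℕ)) : ℝ) * ((j - 1) / (2 * m)) = 1 := by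
        push_cast; field_simp
      rw [this, Real.rpow_one]
  have hIntg := integral_mono_of_nonneg (μ := volume)
    (f := fun x => (2 * m / j - 1 : ℝ) * (|Dw w f x| * |pd k (Dw w f) x| ^ (2 * m / j - 2 : ℝ)
      * |pd k (pd k (Dw w f)) x|))
    (Filter.Eventually.of_forall fun x => mul_nonneg (by linarith) (by positivity))
    (((i0.const_mul (ε / 2)).add (i1.const_mul (1 / 2))).add (i2.const_mul K))
    (Filter.Eventually.of_forall hpt)
  have hsum := integral_add ((i0.const_mul (ε / 2)).add (i1.const_mul (1 / 2))) (i2.const_mul K)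
  have hsum2 := integral_add (i0.const_mul (ε / 2)) (i1.const_mul (1 / 2))
  simp only [Pi.add_apply] at hsum hIntg
  simp only [hsum2, integral_const_mul] at hsum
  have e0 : (∫ x, if j = 1 then (0 : ℝ) else |Dw w f x| ^ (2 * m / (j - 1 : ℕ) : ℝ)) =
      (if j = 1 then 0 else ∫ x, |Dw w f x| ^ (2 * m / (j - 1 : ℕ) : ℝ)) := by
    split_ifs <;> simp
  rw [e0] at hsum
  have key' : ∫ x, |Dw (k :: w) f x| ^ (2 * m / j : ℝ) ≤ _ := key.trans (hIntg.trans hsum.le)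
  linarith

lemma gn_chain (m j : ℕ) (hj : 1 ≤ j) (hjm : j < m) :
    ∃ C : ℝ, 0 < C ∧ ∀ f : (Fin n → ℝ) → ℝ, Cls m f → (∀ x, |f x| ≤ 1) →
      ∀ B : ℝ, (∀ v : List (Fin n), v.length = j + 1 →
        ∫ x, |Dw v f x| ^ (2 * m / (j + 1 : ℕ) : ℝ) ≤ B) →
      ∀ w : List (Fin n), w.length = j → ∫ x, |Dw w f x| ^ (2 * m / j : ℝ) ≤ C * B := by
  induction j, hj using Nat.le_induction with
  | base =>
    obtain ⟨K, hK, h⟩ := gn_step (n := n) (le_refl 1) hjm one_pos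
    refine ⟨K, hK, fun f hf hf1 B hB w hw => ?_⟩
    match w, hw with
    | k :: w', hw =>
      have h1 := h f hf hf1 k w' (by simpa using hw)
      have h2 := hB (k :: k :: w') (by simp at hw ⊢; omega)
      simp only [if_true, mul_zero, zero_add] at h1 h2 ⊢
      exact h1.trans (mul_le_mul_of_nonneg_left h2 hK.le)
  | succ j hj ih =>
    obtain ⟨C, hC, hI⟩ := ih (by omega)
    obtain ⟨K, hK, h⟩ := gn_step (n := n) (j := j + 1) (by omega) hjm
      (by positivity : (0 : ℝ) < 1 / (2 * C))
    refine ⟨2 * K, by positivity, fun f hf hf1 B hB w hw => ?_⟩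
    obtain ⟨w0, hw0, hmax⟩ := Set.exists_max_image {l : List (Fin n) | l.length = j + 1}
      (fun w => ∫ x, |Dw w f x| ^ (2 * m / (j + 1 : ℕ) : ℝ)) (List.finite_length_eq _ _) ⟨w, hw⟩
    have h3 := hI f hf hf1 _ (fun v hv => hmax v hv)
    refine (hmax w hw).trans ?_
    match w0, hw0, h3 with
    | k :: w', hw0, h3 =>
      have hl : w'.length = j := by simpa using hw0
      have h1 := h f hf hf1 k w' (by omega)
      have h2 := hB (k :: k :: w') (by simp; omega)
      have h4 := h3 w' hl
      rw [if_neg (by omega)] at h1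
      simp only [Nat.add_sub_cancel] at h1
      have h5 : 1 / (2 * C) * ∫ x, |Dw w' f x| ^ (2 * m / j : ℝ) ≤
          1 / 2 * ∫ x, |Dw (k :: w') f x| ^ (2 * m / (j + 1 : ℕ) : ℝ) := by
        refine (mul_le_mul_of_nonneg_left h4 (by positivity)).trans (le_of_eq ?_)
        field_simp
      have h6 := mul_le_mul_of_nonneg_left h2 hK.le
      linarith

lemma gn_main (m : ℕ) (d : ℕ) : ∀ j : ℕ, 1 ≤ j → j + d = m →
    ∃ C : ℝ, 0 < C ∧ ∀ f : (Fin n → ℝ) → ℝ, Cls m f → (∀ x, |f x| ≤ 1) →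
      ∀ B : ℝ, (∀ v : List (Fin n), v.length = m → ∫ x, Dw v f x ^ 2 ≤ B) →
      ∀ w : List (Fin n), w.length = j → ∫ x, |Dw w f x| ^ (2 * m / j : ℝ) ≤ C * B := by
  induction d with
  | zero =>
    intro j hj hjm
    refine ⟨1, one_pos, fun f hf hf1 B hB w hw => ?_⟩
    obtain rfl : j = m := by omega
    have : (2 * j / j : ℝ) = (2 : ℕ) := by
      have : (0 : ℝ) < j := by exact_mod_cast hj
      push_cast; field_simp
    simp only [this, Real.rpow_natCast, sq_abs, one_mul]
    exact hB w hw
  | succ d ih =>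
    intro j hj hjm
    obtain ⟨C1, hC1, h1⟩ := ih (j + 1) (by omega) (by omega)
    obtain ⟨C2, hC2, h2⟩ := gn_chain (n := n) m j hj (by omega)
    refine ⟨C2 * C1, by positivity, fun f hf hf1 B hB w hw => ?_⟩
    rw [mul_assoc]
    exact h2 f hf hf1 _ (h1 f hf hf1 B hB) w hw

lemma Cls.cmul {m : ℕ} {f : (Fin n → ℝ) → ℝ} (hf : Cls m f) (c : ℝ) :
    Cls m (fun x => c * f x) := by
  refine ⟨contDiff_const.mul hf.1, fun w hw => ?_⟩
  rw [Dw_const_mul hf.1]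
  exact (hf.2 w hw).cmul c

/-- Normalized product estimate. -/
lemma prod_est_one (p q : ℕ) :
    ∃ C : ℝ, 0 < C ∧ ∀ f g : (Fin n → ℝ) → ℝ, Cls (p + q) f → Cls (p + q) g →
      (∀ x, |f x| ≤ 1) → (∀ x, |g x| ≤ 1) → ∀ B : ℝ,
      (∀ v : List (Fin n), v.length = p + q → ∫ x, Dw v f x ^ 2 ≤ B) →
      (∀ v : List (Fin n), v.length = p + q → ∫ x, Dw v g x ^ 2 ≤ B) →
      ∀ a b : List (Fin n), a.length = p → b.length = q →
      ∫ x, (Dw a f x * Dw b g x) ^ 2 ≤ C * B := by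
  rcases Nat.eq_zero_or_pos p with hp | hp
  · subst hp
    refine ⟨1, one_pos, fun f g hf hg hf1 hg1 B hB1 hB2 a b ha hb => ?_⟩
    have : a = [] := List.length_eq_zero_iff.1 ha
    subst this
    rw [one_mul]
    refine le_trans ?_ (hB2 b (by omega))
    refine integral_mono_of_nonneg (Filter.Eventually.of_forall fun x => sq_nonneg _)
      (hg.2 b (by omega)).2.2 (Filter.Eventually.of_forall fun x => ?_)
    simp only [Dw, mul_pow]
    have : f x ^ 2 ≤ 1 := by rw [← sq_abs]; exact pow_le_one₀ (abs_nonneg _) (hf1 x)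
    nlinarith [sq_nonneg (Dw b g x)]
  rcases Nat.eq_zero_or_pos q with hq | hq
  · subst hq
    refine ⟨1, one_pos, fun f g hf hg hf1 hg1 B hB1 hB2 a b ha hb => ?_⟩
    have : b = [] := List.length_eq_zero_iff.1 hb
    subst this
    rw [one_mul]
    refine le_trans ?_ (hB1 a (by omega))
    refine integral_mono_of_nonneg (Filter.Eventually.of_forall fun x => sq_nonneg _)
      (hf.2 a (by omega)).2.2 (Filter.Eventually.of_forall fun x => ?_)
    simp only [Dw, mul_pow]
    have : g x ^ 2 ≤ 1 := by rw [← sq_abs]; exact pow_le_one₀ (abs_nonneg _) (hg1 x)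
    nlinarith [sq_nonneg (Dw a f x)]
  obtain ⟨C1, hC1, h1⟩ := gn_main (n := n) (p + q) q p hp rfl
  obtain ⟨C2, hC2, h2⟩ := gn_main (n := n) (p + q) p q hq (by omega)
  have hp' : (0 : ℝ) < p := by exact_mod_cast hp
  have hq' : (0 : ℝ) < q := by exact_mod_cast hq
  refine ⟨C1 + C2, by positivity, fun f g hf hg hf1 hg1 B hB1 hB2 a b ha hb => ?_⟩
  have i1 := (hf.2 a (by omega)).rpow_int (gn_exp (m := p + q) hp (by omega))
  have i2 := (hg.2 b (by omega)).rpow_int (gn_exp (m := p + q) hq (by omega))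
  have k1 := h1 f hf hf1 B hB1 a ha
  have k2 := h2 g hg hg1 B hB2 b hb
  have hle : ∫ x, (Dw a f x * Dw b g x) ^ 2 ≤ ∫ x, (|Dw a f x| ^ (2 * (p + q : ℕ) / p : ℝ)
      + |Dw b g x| ^ (2 * (p + q : ℕ) / q : ℝ)) := by
    refine integral_mono_of_nonneg (Filter.Eventually.of_forall fun x => sq_nonneg _)
      (i1.add i2) (Filter.Eventually.of_forall fun x => ?_)
    have := Real.geom_mean_le_arith_mean2_weighted (w₁ := p / (p + q : ℝ)) (w₂ := q / (p + q : ℝ))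
      (p₁ := |Dw a f x| ^ (2 * (p + q : ℕ) / p : ℝ)) (p₂ := |Dw b g x| ^ (2 * (p + q : ℕ) / q : ℝ))
      (by positivity) (by positivity) (by positivity) (by positivity) (by field_simp)
    rw [← Real.rpow_mul (abs_nonneg _), ← Real.rpow_mul (abs_nonneg _)] at this
    have e1 : (2 * (p + q : ℕ) / p : ℝ) * (p / (p + q : ℝ)) = (2 : ℕ) := by
      push_cast; field_simp
    have e2 : (2 * (p + q : ℕ) / q : ℝ) * (q / (p + q : ℝ)) = (2 : ℕ) := by
      push_cast; field_simp
    rw [e1, e2, Real.rpow_natCast, Real.rpow_natCast, sq_abs, sq_abs] at this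
    simp only [mul_pow]
    refine this.trans (add_le_add ?_ ?_)
    · exact mul_le_of_le_one_left (by positivity) (by rw [div_le_one (by positivity)]; linarith)
    · exact mul_le_of_le_one_left (by positivity) (by rw [div_le_one (by positivity)]; linarith)
  rw [integral_add i1 i2] at hle
  linarith

/-- Product estimate. -/
lemma prod_est (p q : ℕ) :
    ∃ C : ℝ, 0 < C ∧ ∀ f g : (Fin n → ℝ) → ℝ, Cls (p + q) f → Cls (p + q) g →
      ∀ M : ℝ, 0 < M → (∀ x, |f x| ≤ M) → (∀ x, |g x| ≤ M) → ∀ B : ℝ,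
      (∀ v : List (Fin n), v.length = p + q → ∫ x, Dw v f x ^ 2 ≤ B) →
      (∀ v : List (Fin n), v.length = p + q → ∫ x, Dw v g x ^ 2 ≤ B) →
      ∀ a b : List (Fin n), a.length = p → b.length = q →
      ∫ x, (Dw a f x * Dw b g x) ^ 2 ≤ C * M ^ 2 * B := by
  obtain ⟨C, hC, h⟩ := prod_est_one (n := n) p q
  refine ⟨C, hC, fun f g hf hg M hM hf1 hg1 B hB1 hB2 a b ha hb => ?_⟩
  have hsc : ∀ f : (Fin n → ℝ) → ℝ, (∀ x, |f x| ≤ M) → ∀ x, |M⁻¹ * f x| ≤ 1 := by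
    intro f hf x
    rw [abs_mul, abs_of_pos (by positivity : 0 < M⁻¹), inv_mul_le_iff₀ hM, mul_one]
    exact hf x
  have hscB : ∀ f : (Fin n → ℝ) → ℝ, Sm f →
      (∀ v : List (Fin n), v.length = p + q → ∫ x, Dw v f x ^ 2 ≤ B) →
      ∀ v : List (Fin n), v.length = p + q → ∫ x, Dw v (fun y => M⁻¹ * f y) x ^ 2
        ≤ (M⁻¹) ^ 2 * B := by
    intro f hf hB v hv
    simp only [Dw_const_mul hf, mul_pow, integral_const_mul]
    exact mul_le_mul_of_nonneg_left (hB v hv) (by positivity)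
  have := h _ _ (hf.cmul M⁻¹) (hg.cmul M⁻¹) (hsc f hf1) (hsc g hg1) _ (hscB f hf.1 hB1)
    (hscB g hg.1 hB2) a b ha hb
  simp only [Dw_const_mul hf.1, Dw_const_mul hg.1] at this
  have e : (fun x => (M⁻¹ * Dw a f x * (M⁻¹ * Dw b g x)) ^ 2)
      = fun x => (M⁻¹) ^ 4 * (Dw a f x * Dw b g x) ^ 2 := by funext x; ring
  rw [e, integral_const_mul] at this
  have h2 := mul_le_mul_of_nonneg_left this (by positivity : 0 ≤ M ^ 4)
  have e1 : M ^ 4 * (M⁻¹ ^ 4 * ∫ x, (Dw a f x * Dw b g x) ^ 2) = ∫ x, (Dw a f x * Dw b g x) ^ 2 := by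
    field_simp
  have e2 : M ^ 4 * (C * (M⁻¹ ^ 2 * B)) = C * M ^ 2 * B := by field_simp
  rw [e1, e2] at h2
  exact h2

end


/-! ### Part C: the energy estimate at a fixed time -/

section
variable {n : ℕ}

/-- Integrable with integral bounded by `c * K`. -/
def Bd (K c : ℝ) (F : (Fin n → ℝ) → ℝ) : Prop := Integrable F ∧ |∫ x, F x| ≤ c * K

lemma Bd.add {K c d : ℝ} {F G : (Fin n → ℝ) → ℝ} (hF : Bd K c F) (hG : Bd K d G) :
    Bd K (c + d) (fun x => F x + G x) := by
  refine ⟨hF.1.add hG.1, ?_⟩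
  rw [integral_add hF.1 hG.1, add_mul]
  exact (abs_add_le _ _).trans (add_le_add hF.2 hG.2)

lemma Bd.cmul {K c : ℝ} {F : (Fin n → ℝ) → ℝ} (hF : Bd K c F) (a : ℝ) :
    Bd K (|a| * c) (fun x => a * F x) := by
  refine ⟨hF.1.const_mul a, ?_⟩
  rw [integral_const_mul, abs_mul, mul_assoc]
  exact mul_le_mul_of_nonneg_left hF.2 (abs_nonneg _)

lemma Bd.fsum {ι : Type*} (S : Finset ι) {K c : ℝ} {F : ι → (Fin n → ℝ) → ℝ}
    (hF : ∀ i, Bd K c (F i)) : Bd K (S.card * c) (fun x => ∑ i ∈ S, F i x) := by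
  refine ⟨integrable_finsetSum _ fun i _ => (hF i).1, ?_⟩
  rw [integral_finsetSum _ fun i _ => (hF i).1]
  refine (Finset.abs_sum_le_sum_abs _ _).trans ?_
  refine (Finset.sum_le_sum fun i _ => (hF i).2).trans (le_of_eq ?_)
  simp; ring

/-- Class of gradient components. -/
def GC (m : ℕ) (M B : ℝ) (g : (Fin n → ℝ) → ℝ) : Prop :=
  Cls m g ∧ (∀ x, |g x| ≤ M) ∧ ∀ v : List (Fin n), v.length + 1 ≤ m → ∫ x, Dw v g x ^ 2 ≤ B

lemma Cls.mono {m l : ℕ} {f : (Fin n → ℝ) → ℝ} (hf : Cls m f) (h : l ≤ m) : Cls l f :=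
  ⟨hf.1, fun w hw => hf.2 w (hw.trans h)⟩

lemma Cls.pd {m : ℕ} {f : (Fin n → ℝ) → ℝ} (hf : Cls (m + 1) f) (k : Fin n) : Cls m (pd k f) := by
  refine ⟨hf.1.pd k, fun w hw => ?_⟩
  rw [Dw_pd hf.1]
  exact hf.2 (k :: w) (by simp; omega)

lemma term_est (a b : List (Fin n)) : ∃ c : ℝ, 0 < c ∧ ∀ (m : ℕ) (f g P : (Fin n → ℝ) → ℝ)
    (M B : ℝ), a.length + b.length + 1 ≤ m → 0 < M → GC m M B f → GC m M B g → BL P →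
    ∫ x, P x ^ 2 ≤ B → BL (fun x => Dw a f x * Dw b g x) ∧
    (a.length + b.length + 1 = m → Bd (M * B) c (fun x => P x * (Dw a f x * Dw b g x))) := by
  obtain ⟨C, hC, h⟩ := prod_est (n := n) a.length b.length
  refine ⟨(1 + C) / 2, by positivity, fun m f g P M B hm hM hf hg hP hPB => ?_⟩
  have hbl : BL (fun x => Dw a f x * Dw b g x) :=
    (hf.1.2 a (by omega)).mul (hg.1.2 b (by omega))
  refine ⟨hbl, fun hm' => ?_⟩
  have h1 := h f g (hf.1.mono (by omega)) (hg.1.mono (by omega)) M hM hf.2.1 hg.2.1 B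
    (fun v hv => hf.2.2 v (by omega)) (fun v hv => hg.2.2 v (by omega)) a b rfl rfl
  refine ⟨hP.mul_int hbl, ?_⟩
  have h2 : |∫ x, P x * (Dw a f x * Dw b g x)| ≤
      ∫ x, (M / 2 * P x ^ 2 + 1 / (2 * M) * (Dw a f x * Dw b g x) ^ 2) := by
    refine (abs_integral_le_integral_abs).trans ?_
    refine integral_mono_of_nonneg (Filter.Eventually.of_forall fun x => abs_nonneg _)
      ((hP.2.2.const_mul _).add (hbl.2.2.const_mul _)) (Filter.Eventually.of_forall fun x => ?_)
    simp only [abs_mul (P x)]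
    set y := Dw a f x * Dw b g x
    rw [← sq_abs (P x), ← sq_abs y]
    have : M / 2 * |P x| ^ 2 + 1 / (2 * M) * |y| ^ 2 - |P x| * |y|
        = (M * |P x| - |y|) ^ 2 / (2 * M) := by field_simp; ring
    have : 0 ≤ (M * |P x| - |y|) ^ 2 / (2 * M) := by positivity
    linarith
  rw [integral_add (hP.2.2.const_mul _) (hbl.2.2.const_mul _), integral_const_mul,
    integral_const_mul] at h2
  have h3 := mul_le_mul_of_nonneg_left hPB (by positivity : 0 ≤ M / 2)
  have h4 := mul_le_mul_of_nonneg_left h1 (by positivity : 0 ≤ 1 / (2 * M))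
  have h5 : 1 / (2 * M) * (C * M ^ 2 * B) = C / 2 * (M * B) := by field_simp
  rw [h5] at h4
  linarith

lemma list_est (m : ℕ) (L : List (List (Fin n) × Fin n × List (Fin n))) :
    (∀ p ∈ L, p.1.length + p.2.2.length + 1 = m) →
    ∃ c : ℝ, 0 ≤ c ∧ ∀ (f g P : (Fin n → ℝ) → ℝ)
    (M B : ℝ), 0 < M → (∀ k, GC m M B (pd k f)) → GC m M B g → BL P →
    ∫ x, P x ^ 2 ≤ B →
    BL (fun x => (L.map fun p => Dw p.1 (pd p.2.1 f) x * Dw p.2.2 g x).sum) ∧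
    Bd (M * B) c (fun x => P x * (L.map fun p => Dw p.1 (pd p.2.1 f) x * Dw p.2.2 g x).sum) := by
  induction L with
  | nil =>
    intro _
    refine ⟨0, le_refl _, fun f g P M B hM hf hg hP hPB => ⟨?_, ?_⟩⟩
    · simp only [List.map_nil, List.sum_nil]
      exact ⟨continuous_const, ⟨0, le_refl _, by simp⟩, by simp⟩
    · simp [Bd]
  | cons q L ih =>
    intro hL
    obtain ⟨c, hc, h⟩ := ih (fun p hp => hL p (List.mem_cons_of_mem _ hp))
    obtain ⟨d, hd, h'⟩ := term_est q.1 q.2.2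
    have hq := hL q (List.mem_cons_self)
    refine ⟨d + c, by positivity, fun f g P M B hM hf hg hP hPB => ?_⟩
    obtain ⟨k1, k2⟩ := h f g P M B hM hf hg hP hPB
    obtain ⟨l1, l2⟩ := h' m (pd q.2.1 f) g P M B hq.le hM (hf _) hg hP hPB
    simp only [List.map_cons, List.sum_cons, mul_add]
    exact ⟨l1.add k1, (l2 hq).add k2⟩

/-- Commutator estimate. -/
lemma comm_est (w : List (Fin n)) : ∃ c : ℝ, 0 ≤ c ∧ ∀ (f g P : (Fin n → ℝ) → ℝ)
    (M B : ℝ), 0 < M → Sm f → (∀ k, GC w.length M B (pd k f)) → GC w.length M B g → BL P →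
    ∫ x, P x ^ 2 ≤ B →
    ∃ Q : (Fin n → ℝ) → ℝ, (∀ x, Dw w (fun x => f x * g x) x = f x * Dw w g x + Q x) ∧
    Bd (M * B) c (fun x => P x * Q x) := by
  obtain ⟨L, hL, h⟩ := leibniz w
  obtain ⟨c, hc, h'⟩ := list_est w.length L hL
  refine ⟨c, hc, fun f g P M B hM hfs hf hg hP hPB => ⟨_, fun x => ?_, 
    (h' f g P M B hM hf hg hP hPB).2⟩⟩
  rw [h f g hfs hg.1.1]

lemma ibp_est {φ P V : (Fin n → ℝ) → ℝ} {C M B : ℝ} (j : Fin n) (hφ : Sm φ)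
    (hC : ∀ x, |φ x| ≤ C) (hM0 : 0 ≤ M) (hM : ∀ x, |pd j φ x| ≤ M) (hP : Sm P) (hV : Sm V)
    (bP : BL P) (bV : BL V) (bP' : BL (pd j P)) (bV' : BL (pd j V))
    (hPB : ∫ x, P x ^ 2 ≤ B) (hVB : ∫ x, V x ^ 2 ≤ B) :
    Bd (M * B) 1 (fun x => φ x * (P x * pd j V x + V x * pd j P x)) := by
  have hi : Integrable (fun x => φ x * (P x * pd j V x + V x * pd j P x)) :=
    bdd_int hφ.continuous hC ((bP.mul_int bV').add (bV.mul_int bP'))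
  refine ⟨hi, ?_⟩
  have hd : ∀ x, fderiv ℝ (fun y => P y * V y) x (Pi.single j 1)
      = P x * pd j V x + V x * pd j P x := by
    intro x
    have := congrFun (pd_mul hP hV j) x
    simp only [pd] at this ⊢
    rw [this]; ring
  have hi2 : Integrable (fun x => pd j φ x * (P x * V x)) :=
    bdd_int (hφ.pd j).continuous hM (bP.mul_int bV)
  have ibp := integral_mul_fderiv_eq_neg_fderiv_mul_of_integrable (μ := volume) (f := φ)
    (g := fun y => P y * V y) (v := Pi.single j 1) hi2
    (by simp only [hd]; exact hi) (bdd_int hφ.continuous hC (bP.mul_int bV))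
    (fun x _ => hφ.diff x) (fun x _ => Sm.diff (hP.mul hV) x)
  simp only [hd] at ibp
  rw [ibp, abs_neg, one_mul]
  refine abs_integral_le_integral_abs.trans ?_
  have : ∫ x, |pd j φ x * (P x * V x)| ≤ ∫ x, (M / 2 * P x ^ 2 + M / 2 * V x ^ 2) := by
    refine integral_mono_of_nonneg (Filter.Eventually.of_forall fun x => abs_nonneg _)
      ((bP.2.2.const_mul _).add (bV.2.2.const_mul _)) (Filter.Eventually.of_forall fun x => ?_)
    simp only [abs_mul]
    rw [← sq_abs (P x), ← sq_abs (V x)]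
    have h1 := mul_le_mul_of_nonneg_right (hM x) (by positivity : 0 ≤ |P x| * |V x|)
    nlinarith [sq_nonneg (|P x| - |V x|)]
  refine this.trans ?_
  rw [integral_add (bP.2.2.const_mul _) (bV.2.2.const_mul _), integral_const_mul,
    integral_const_mul]
  have h3 := mul_le_mul_of_nonneg_left hPB (by positivity : 0 ≤ M / 2)
  have h4 := mul_le_mul_of_nonneg_left hVB (by positivity : 0 ≤ M / 2)
  linarith

/-- The energy estimate for one word of derivatives at a fixed time. -/
lemma energy_fixed (s : ℕ) (κ : ℝ) (hκ : 0 < κ) (w : List (Fin n)) (hw : w.length ≤ s) :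
    ∃ c : ℝ, 0 ≤ c ∧ ∀ (rbar : ℝ) (ρ r : (Fin n → ℝ) → ℝ) (u : Fin n → (Fin n → ℝ) → ℝ)
      (M B : ℝ), 0 < M → Cls (s + 1) ρ → (∀ i, Cls (s + 1) (u i)) → Sm r →
      (∀ x, ρ x = r x - rbar) →
      (∀ k x, |pd k r x| ≤ M) → (∀ i k x, |pd k (u i) x| ≤ M) →
      (∀ v : List (Fin n), v.length ≤ s → ∫ x, Dw v ρ x ^ 2 ≤ B) →
      (∀ i, ∀ v : List (Fin n), v.length ≤ s → ∫ x, Dw v (u i) x ^ 2 ≤ B) →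
      |∫ x, (Dw w ρ x * Dw w (fun y => ∑ j, (u j y * pd j r y + κ * (r y * pd j (u j) y))) x
        + κ * ∑ i, Dw w (u i) x *
          Dw w (fun y => (∑ j, u j y * pd j (u i) y) + r y * pd i r y) x)| ≤ c * (M * B) := by
  obtain ⟨c, hc, hcomm⟩ := comm_est w
  refine ⟨((Finset.univ : Finset (Fin n)).card * (|1 / 2| * 1 + |κ| * 1 + c + |κ| * c)
    + |κ| * ((Finset.univ : Finset (Fin n)).card *
        ((Finset.univ : Finset (Fin n)).card * (|1 / 2| * 1 + c) + c))), by positivity, ?_⟩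
  intro rbar ρ r u M B hM hρ hu hr hρr hMr hMu hBρ hBu
  have hpdr : ∀ k, pd k r = pd k ρ := by
    intro k
    have : ρ = fun x => r x - rbar := funext hρr
    rw [this, pd_sub_const]
  have hgρ : ∀ k, GC w.length M B (pd k r) := by
    intro k
    refine ⟨?_, hMr k, fun v hv => ?_⟩
    · rw [hpdr]; exact (hρ.pd k).mono hw
    · rw [hpdr, Dw_pd hρ.1]; exact hBρ (k :: v) (by simp; omega)
  have hgu : ∀ i k, GC w.length M B (pd k (u i)) := by
    intro i k
    refine ⟨((hu i).pd k).mono hw, hMu i k, fun v hv => ?_⟩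
    rw [Dw_pd (hu i).1]; exact hBu i (k :: v) (by simp; omega)
  have hP : BL (Dw w ρ) := hρ.2 w (by omega)
  have hP' : ∀ j, BL (pd j (Dw w ρ)) := fun j => hρ.2 (j :: w) (by simp; omega)
  have hV : ∀ i, BL (Dw w (u i)) := fun i => (hu i).2 w (by omega)
  have hV' : ∀ i j, BL (pd j (Dw w (u i))) := fun i j => (hu i).2 (j :: w) (by simp; omega)
  have sP := hρ.1.Dw w
  have sV := fun i => (hu i).1.Dw w
  have bP := hBρ w hw
  have bV := fun i => hBu i w hw
  have DPj : ∀ j, Dw w (pd j r) = pd j (Dw w ρ) := fun j => by rw [hpdr, Dw_pd hρ.1]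
  have DVj : ∀ i j, Dw w (pd j (u i)) = pd j (Dw w (u i)) := fun i j => Dw_pd (hu i).1 w j
  obtain ⟨Cr, hCr⟩ : ∃ Cr, ∀ x, |r x| ≤ Cr := by
    obtain ⟨C, h0, hC⟩ := (hρ.2 [] (by simp)).2.1
    refine ⟨C + |rbar|, fun x => ?_⟩
    have : r x = Dw [] ρ x + rbar := by simp [Dw, hρr]
    rw [this]
    exact (abs_add_le _ _).trans (add_le_add (hC x) (le_refl _))
  have hCu : ∀ i, ∃ C, ∀ x, |u i x| ≤ C := fun i => by
    obtain ⟨C, h0, hC⟩ := ((hu i).2 [] (by simp)).2.1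
    exact ⟨C, hC⟩
  choose Cu hCu using hCu
  -- commutators
  have q1 := fun j => hcomm (u j) (pd j r) (Dw w ρ) M B hM (hu j).1 (hgu j) (hgρ j) hP bP
  have q2 := fun j => hcomm r (pd j (u j)) (Dw w ρ) M B hM hr hgρ (hgu j j) hP bP
  have q3 := fun i j => hcomm (u j) (pd j (u i)) (Dw w (u i)) M B hM (hu j).1 (hgu j) (hgu i j)
    (hV i) (bV i)
  have q4 := fun i => hcomm r (pd i r) (Dw w (u i)) M B hM hr hgρ (hgρ i) (hV i) (bV i)
  choose Q1 e1 b1 using q1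
  choose Q2 e2 b2 using q2
  choose Q3 e3 b3 using q3
  choose Q4 e4 b4 using q4
  -- main terms
  have m1 := fun j => ibp_est j (hu j).1 (hCu j) hM.le (hMu j j) sP sP hP hP (hP' j) (hP' j) bP bP
  have m2 := fun j => ibp_est j hr hCr hM.le (hMr j) sP (sV j) hP (hV j) (hP' j) (hV' j j) bP (bV j)
  have m3 := fun i j => ibp_est j (hu j).1 (hCu j) hM.le (hMu j j) (sV i) (sV i) (hV i) (hV i)
    (hV' i j) (hV' i j) (bV i) (bV i)
  have t1 := Bd.fsum (Finset.univ : Finset (Fin n)) (fun j =>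
    ((((m1 j).cmul (1 / 2)).add ((m2 j).cmul κ)).add (b1 j)).add ((b2 j).cmul κ))
  have t2 := (Bd.fsum (Finset.univ : Finset (Fin n)) (fun i =>
    (Bd.fsum (Finset.univ : Finset (Fin n)) (fun j =>
      ((m3 i j).cmul (1 / 2)).add (b3 i j))).add (b4 i))).cmul κ
  have tot := (t1.add t2).2
  refine le_trans (le_of_eq ?_) tot
  congr 1
  refine integral_congr_ae (Filter.Eventually.of_forall fun x => ?_)
  have s1 : ∀ j, Sm (fun y => u j y * pd j r y) := fun j => (hu j).1.mul (hr.pd j)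
  have s2 : ∀ j, Sm (fun y => r y * pd j (u j) y) := fun j => hr.mul ((hu j).1.pd j)
  have s3 : ∀ i j, Sm (fun y => u j y * pd j (u i) y) := fun i j => (hu j).1.mul ((hu i).1.pd j)
  have s4 : ∀ i, Sm (fun y => r y * pd i r y) := fun i => hr.mul (hr.pd i)
  have E1 : Dw w (fun y => ∑ j, (u j y * pd j r y + κ * (r y * pd j (u j) y))) x =
      ∑ j, (u j x * pd j (Dw w ρ) x + Q1 j x + κ * (r x * pd j (Dw w (u j)) x + Q2 j x)) := by
    rw [Dw_sum _ (fun j => (s1 j).add (contDiff_const.mul (s2 j)))]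
    refine Finset.sum_congr rfl fun j _ => ?_
    rw [Dw_add (s1 j) (contDiff_const.mul (s2 j)), Dw_const_mul (s2 j)]
    simp only [e1, e2, DPj, DVj]
  have E2 : ∀ i, Dw w (fun y => (∑ j, u j y * pd j (u i) y) + r y * pd i r y) x =
      (∑ j, (u j x * pd j (Dw w (u i)) x + Q3 i j x)) + (r x * pd i (Dw w ρ) x + Q4 i x) := by
    intro i
    rw [Dw_add (Sm.fsum (s3 i)) (s4 i), Dw_sum _ (s3 i)]
    simp only [e3, e4, DPj, DVj]
  simp only [E1, E2]
  rw [Finset.mul_sum, Finset.mul_sum, Finset.mul_sum, ← Finset.sum_add_distrib,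
    ← Finset.sum_add_distrib]
  refine Finset.sum_congr rfl fun j _ => ?_
  rw [mul_add (Dw w (u j) x), Finset.mul_sum]
  have E3 : ∑ i, Dw w (u j) x * (u i x * pd i (Dw w (u j)) x + Q3 j i x)
      = ∑ i, (1 / 2 * (u i x * (Dw w (u j) x * pd i (Dw w (u j)) x
        + Dw w (u j) x * pd i (Dw w (u j)) x)) + Dw w (u j) x * Q3 j i x) := by
    refine Finset.sum_congr rfl fun i _ => ?_
    ring
  rw [E3]
  ring

end


/-! ### Part D: regularity in time -/

section
variable {n : ℕ}

open Filter Topology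

/-- Bounded and continuous in time with values in `L²`. -/
def TC (T : ℝ) (f : ℝ → (Fin n → ℝ) → ℝ) : Prop :=
  (∃ C, 0 ≤ C ∧ ∀ t ∈ Icc 0 T, ∀ x, |f t x| ≤ C) ∧ (∀ t ∈ Icc 0 T, BL (f t)) ∧
  ∀ t₀ ∈ Icc 0 T, Tendsto (fun t => ∫ x, (f t x - f t₀ x) ^ 2) (𝓝[Icc 0 T] t₀) (𝓝 0)

lemma BL.sub {f g : (Fin n → ℝ) → ℝ} (hf : BL f) (hg : BL g) : BL (fun x => f x - g x) := by
  simpa [sub_eq_add_neg] using hf.add (hg.cmul (-1))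

lemma TC.congr {T : ℝ} {f g : ℝ → (Fin n → ℝ) → ℝ} (hf : TC T f)
    (h : ∀ t ∈ Icc 0 T, f t = g t) : TC T g := by
  obtain ⟨⟨C, h0, hC⟩, h2, h3⟩ := hf
  refine ⟨⟨C, h0, fun t ht => h t ht ▸ hC t ht⟩, fun t ht => h t ht ▸ h2 t ht, fun t₀ ht₀ => ?_⟩
  refine (h3 t₀ ht₀).congr' ?_
  filter_upwards [self_mem_nhdsWithin] with t ht
  rw [h t ht, h t₀ ht₀]

lemma TC.of_bound {T : ℝ} {f : ℝ → (Fin n → ℝ) → ℝ} {a b : ℝ → (Fin n → ℝ) → ℝ} {K : ℝ}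
    (ha : TC T a) (hb : TC T b)
    (h1 : ∃ C, 0 ≤ C ∧ ∀ t ∈ Icc 0 T, ∀ x, |f t x| ≤ C) (h2 : ∀ t ∈ Icc 0 T, BL (f t))
    (h : ∀ t ∈ Icc 0 T, ∀ t₀ ∈ Icc 0 T, ∀ x, (f t x - f t₀ x) ^ 2 ≤
      K * (a t x - a t₀ x) ^ 2 + K * (b t x - b t₀ x) ^ 2) : TC T f := by
  refine ⟨h1, h2, fun t₀ ht₀ => ?_⟩
  have hlim := ((ha.2.2 t₀ ht₀).const_mul K).add ((hb.2.2 t₀ ht₀).const_mul K)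
  simp only [mul_zero, add_zero] at hlim
  refine tendsto_of_tendsto_of_tendsto_of_le_of_le' tendsto_const_nhds hlim
    (Eventually.of_forall fun t => integral_nonneg fun x => sq_nonneg _) ?_
  filter_upwards [self_mem_nhdsWithin] with t ht
  have i1 := ((ha.2.1 t ht).sub (ha.2.1 t₀ ht₀)).2.2
  have i2 := ((hb.2.1 t ht).sub (hb.2.1 t₀ ht₀)).2.2
  rw [← integral_const_mul, ← integral_const_mul,
    ← integral_add (i1.const_mul K) (i2.const_mul K)]
  exact integral_mono_of_nonneg (Eventually.of_forall fun x => sq_nonneg _)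
    ((i1.const_mul K).add (i2.const_mul K)) (Eventually.of_forall fun x => h t ht t₀ ht₀ x)

lemma TC.add {T : ℝ} {f g : ℝ → (Fin n → ℝ) → ℝ} (hf : TC T f) (hg : TC T g) :
    TC T (fun t x => f t x + g t x) := by
  refine TC.of_bound (K := 2) hf hg ?_ (fun t ht => (hf.2.1 t ht).add (hg.2.1 t ht)) ?_
  · obtain ⟨C, h0, hC⟩ := hf.1
    obtain ⟨D, k0, hD⟩ := hg.1
    exact ⟨C + D, by positivity, fun t ht x => (abs_add_le _ _).trans
      (add_le_add (hC t ht x) (hD t ht x))⟩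
  · intro t _ t₀ _ x
    nlinarith [sq_nonneg ((f t x - f t₀ x) - (g t x - g t₀ x))]

lemma TC.cmul {T : ℝ} {f : ℝ → (Fin n → ℝ) → ℝ} (hf : TC T f) (c : ℝ) :
    TC T (fun t x => c * f t x) := by
  refine TC.of_bound (K := c ^ 2) hf hf ?_ (fun t ht => (hf.2.1 t ht).cmul c) ?_
  · obtain ⟨C, h0, hC⟩ := hf.1
    refine ⟨|c| * C, by positivity, fun t ht x => ?_⟩
    rw [abs_mul]
    exact mul_le_mul_of_nonneg_left (hC t ht x) (abs_nonneg _)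
  · intro t _ t₀ _ x
    have : (c * f t x - c * f t₀ x) ^ 2 = c ^ 2 * (f t x - f t₀ x) ^ 2 := by ring
    rw [this]
    have : 0 ≤ c ^ 2 * (f t x - f t₀ x) ^ 2 := by positivity
    linarith

lemma TC.mul {T : ℝ} {f g : ℝ → (Fin n → ℝ) → ℝ} (hf : TC T f) (hg : TC T g) :
    TC T (fun t x => f t x * g t x) := by
  obtain ⟨C, h0, hC⟩ := hf.1
  obtain ⟨D, k0, hD⟩ := hg.1
  refine TC.of_bound (K := 2 * (C ^ 2 + D ^ 2)) hf hg ?_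
    (fun t ht => (hf.2.1 t ht).mul (hg.2.1 t ht)) ?_
  · refine ⟨C * D, by positivity, fun t ht x => ?_⟩
    rw [abs_mul]
    exact mul_le_mul (hC t ht x) (hD t ht x) (abs_nonneg _) h0
  · intro t ht t₀ ht₀ x
    have e : f t x * g t x - f t₀ x * g t₀ x = f t x * (g t x - g t₀ x)
      + (f t x - f t₀ x) * g t₀ x := by ring
    have h1 : f t x ^ 2 ≤ C ^ 2 := sq_le_sq' (abs_le.1 (hC t ht x)).1 (abs_le.1 (hC t ht x)).2
    have h2 : g t₀ x ^ 2 ≤ D ^ 2 := sq_le_sq' (abs_le.1 (hD t₀ ht₀ x)).1 (abs_le.1 (hD t₀ ht₀ x)).2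
    rw [e]
    have e1 := mul_le_mul_of_nonneg_right h1 (sq_nonneg (g t x - g t₀ x))
    have e2 := mul_le_mul_of_nonneg_right h2 (sq_nonneg (f t x - f t₀ x))
    have e3 : 0 ≤ C ^ 2 * (f t x - f t₀ x) ^ 2 := by positivity
    have e4 : 0 ≤ D ^ 2 * (g t x - g t₀ x) ^ 2 := by positivity
    have e5 := sq_nonneg (f t x * (g t x - g t₀ x) - (f t x - f t₀ x) * g t₀ x)
    nlinarith

lemma TC.zero (T : ℝ) : TC T (fun _ (_ : Fin n → ℝ) => (0 : ℝ)) := by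
  refine ⟨⟨0, le_refl _, by simp⟩, fun t _ => ⟨continuous_const, ⟨0, le_refl _, by simp⟩, by simp⟩,
    fun t _ => by simpa using tendsto_const_nhds⟩

lemma TC.fsum {ι : Type*} (S : Finset ι) {T : ℝ} {f : ι → ℝ → (Fin n → ℝ) → ℝ}
    (hf : ∀ i, TC T (f i)) : TC T (fun t x => ∑ i ∈ S, f i t x) := by
  classical
  induction S using Finset.induction_on with
  | empty => simpa using TC.zero T
  | insert a S ha ih =>
    simp only [Finset.sum_insert ha]
    exact (hf a).add ih

lemma TC.lsum {ι : Type*} (L : List ι) {T : ℝ} {f : ι → ℝ → (Fin n → ℝ) → ℝ}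
    (hf : ∀ i ∈ L, TC T (f i)) : TC T (fun t x => (L.map fun i => f i t x).sum) := by
  induction L with
  | nil => simpa using TC.zero T
  | cons a L ih =>
    simp only [List.map_cons, List.sum_cons]
    exact (hf a List.mem_cons_self).add (ih fun i hi => hf i (List.mem_cons_of_mem _ hi))

lemma inner_eq {f g : (Fin n → ℝ) → ℝ} {R S : Lp ℝ 2 (volume : Measure (Fin n → ℝ))}
    (hf : (R : (Fin n → ℝ) → ℝ) =ᵐ[volume] f) (hg : (S : (Fin n → ℝ) → ℝ) =ᵐ[volume] g) :
    inner ℝ R S = ∫ x, f x * g x := by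
  rw [MeasureTheory.L2.inner_def]
  refine integral_congr_ae ?_
  filter_upwards [hf, hg] with x h1 h2
  simp [h1, h2, mul_comm]

lemma dist_sq_eq {f g : (Fin n → ℝ) → ℝ} {R S : Lp ℝ 2 (volume : Measure (Fin n → ℝ))}
    (hf : (R : (Fin n → ℝ) → ℝ) =ᵐ[volume] f) (hg : (S : (Fin n → ℝ) → ℝ) =ᵐ[volume] g) :
    dist R S ^ 2 = ∫ x, (f x - g x) ^ 2 := by
  have h : ((R - S : Lp ℝ 2 (volume : Measure (Fin n → ℝ))) : (Fin n → ℝ) → ℝ)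
      =ᵐ[volume] fun x => f x - g x := by
    filter_upwards [Lp.coeFn_sub R S, hf, hg] with x h1 h2 h3
    rw [h1, Pi.sub_apply, h2, h3]
  rw [dist_eq_norm, ← real_inner_self_eq_norm_sq, inner_eq h h]
  simp only [sq]

lemma TC.of_Lp {T : ℝ} {f : ℝ → (Fin n → ℝ) → ℝ}
    (h1 : ∃ C, ∀ t ∈ Icc 0 T, ∀ x, |f t x| ≤ C) (hc : ∀ t, Continuous (f t))
    (h2 : ∀ t ∈ Icc 0 T, Integrable (fun x => f t x ^ 2))
    {R : ℝ → Lp ℝ 2 (volume : Measure (Fin n → ℝ))} (hR : ContinuousOn R (Icc 0 T))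
    (hRf : ∀ t ∈ Icc 0 T, (R t : (Fin n → ℝ) → ℝ) =ᵐ[volume] f t) : TC T f := by
  obtain ⟨C, hC⟩ := h1
  have hC' : ∀ t ∈ Icc 0 T, ∀ x, |f t x| ≤ |C| := fun t ht x => (hC t ht x).trans (le_abs_self _)
  refine ⟨⟨|C|, abs_nonneg _, hC'⟩, fun t ht => ⟨hc t, ⟨|C|, abs_nonneg _, hC' t ht⟩, h2 t ht⟩,
    fun t₀ ht₀ => ?_⟩
  have := (tendsto_iff_dist_tendsto_zero.1 (hR t₀ ht₀)).pow 2
  rw [zero_pow two_ne_zero] at this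
  refine this.congr' ?_
  filter_upwards [self_mem_nhdsWithin] with t ht
  exact dist_sq_eq (hRf t ht) (hRf t₀ ht₀)

lemma TC.exists_Lp {T : ℝ} {f : ℝ → (Fin n → ℝ) → ℝ} (hf : TC T f) :
    ∃ R : ℝ → Lp ℝ 2 (volume : Measure (Fin n → ℝ)), ContinuousOn R (Icc 0 T) ∧
      ∀ t ∈ Icc 0 T, (R t : (Fin n → ℝ) → ℝ) =ᵐ[volume] f t := by
  have h1 : ∀ t, ∃ R : Lp ℝ 2 (volume : Measure (Fin n → ℝ)), t ∈ Icc 0 T →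
      (R : (Fin n → ℝ) → ℝ) =ᵐ[volume] f t := by
    intro t
    by_cases ht : t ∈ Icc 0 T
    · have hm : MemLp (f t) 2 volume :=
        (memLp_two_iff_integrable_sq (hf.2.1 t ht).1.aestronglyMeasurable).2 (hf.2.1 t ht).2.2
      exact ⟨hm.toLp _, fun _ => hm.coeFn_toLp⟩
    · exact ⟨0, fun h => absurd h ht⟩
  choose R hR using h1
  refine ⟨R, fun t₀ ht₀ => ?_, hR⟩
  refine tendsto_iff_dist_tendsto_zero.2 ?_
  have h2 : Tendsto (fun t => dist (R t) (R t₀) ^ 2) (𝓝[Icc 0 T] t₀) (𝓝 0) := by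
    refine (hf.2.2 t₀ ht₀).congr' ?_
    filter_upwards [self_mem_nhdsWithin] with t ht
    exact (dist_sq_eq (hR t ht) (hR t₀ ht₀)).symm
  have h3 := (Real.continuous_sqrt.tendsto 0).comp h2
  simp only [Real.sqrt_zero] at h3
  refine h3.congr fun t => ?_
  simp [Real.sqrt_sq dist_nonneg]

lemma TC.cont {T : ℝ} {f g : ℝ → (Fin n → ℝ) → ℝ} (hf : TC T f) (hg : TC T g) :
    ContinuousOn (fun t => ∫ x, f t x * g t x) (Icc 0 T) := by
  obtain ⟨R, hR, hRf⟩ := hf.exists_Lp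
  obtain ⟨S, hS, hSg⟩ := hg.exists_Lp
  refine (ContinuousOn.inner (𝕜 := ℝ) hR hS).congr fun t ht => ?_
  exact (inner_eq (hRf t ht) (hSg t ht)).symm

/-- Differentiation of the squared `L²` norm. -/
lemma TC.hasDeriv {T : ℝ} (hT : 0 < T) {F G : ℝ → (Fin n → ℝ) → ℝ} (hF : TC T F) (hG : TC T G)
    (cF : Continuous (Function.uncurry F)) (cG : Continuous (Function.uncurry G))
    (hd : ∀ t x, HasDerivAt (fun τ => F τ x) (G t x) t) {t : ℝ} (ht : t ∈ Icc 0 T) :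
    HasDerivWithinAt (fun t => ∫ x, F t x ^ 2) (2 * ∫ x, F t x * G t x) (Icc 0 T) t := by
  have hcont : ContinuousOn (fun t => 2 * ∫ x, F t x * G t x) (Icc 0 T) :=
    continuousOn_const.mul (hF.cont hG)
  have hbd : ContinuousOn (fun t => (∫ x, F t x * F t x) + ∫ x, G t x * G t x) (Icc 0 T) :=
    (hF.cont hF).add (hG.cont hG)
  obtain ⟨K, hK⟩ := isCompact_Icc.exists_bound_of_continuousOn hbd
  have key : ∀ t ∈ Icc 0 T, ∫ x, F t x ^ 2 = (∫ x, F 0 x ^ 2)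
      + ∫ τ in (0 : ℝ)..t, (2 * ∫ x, F τ x * G τ x) := by
    intro t ht
    have hsub : Set.uIoc 0 t ⊆ Icc 0 T := by
      rw [Set.uIoc_of_le ht.1]
      exact fun y hy => ⟨hy.1.le, hy.2.trans ht.2⟩
    have hcc : Continuous (Function.uncurry fun τ x => 2 * (F τ x * G τ x)) :=
      continuous_const.mul (cF.mul cG)
    have hIntg : Integrable (Function.uncurry fun τ x => 2 * (F τ x * G τ x))
        ((volume.restrict (Set.uIoc 0 t)).prod volume) := by
      rw [integrable_prod_iff hcc.aestronglyMeasurable]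
      have hae : ∀ᵐ τ ∂(volume.restrict (Set.uIoc 0 t)), τ ∈ Icc 0 T :=
        (ae_restrict_mem measurableSet_uIoc).mono fun τ hτ => hsub hτ
      constructor
      · filter_upwards [hae] with τ hτ
        exact ((hF.2.1 τ hτ).mul_int (hG.2.1 τ hτ)).const_mul 2
      · refine Integrable.mono' (g := fun _ => K) ?_
          (hcc.norm.aestronglyMeasurable (μ := (volume.restrict (Set.uIoc 0 t)).prod
            (volume : Measure (Fin n → ℝ)))).integral_prod_right' ?_
        · refine integrable_const_iff.2 (Or.inr ?_)
          constructor
          simp [Set.uIoc_of_le ht.1]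
        · filter_upwards [hae] with τ hτ
          have b := hF.2.1 τ hτ
          have b' := hG.2.1 τ hτ
          refine le_trans ?_ ((le_abs_self _).trans (hK τ hτ))
          rw [Real.norm_of_nonneg (integral_nonneg fun x => norm_nonneg _),
            ← integral_add (b.mul_int b) (b'.mul_int b')]
          refine integral_mono_of_nonneg (Eventually.of_forall fun x => norm_nonneg _)
            ((b.mul_int b).add (b'.mul_int b')) (Eventually.of_forall fun x => ?_)
          simp only [Function.uncurry, Real.norm_eq_abs]
          rw [abs_le]
          constructor <;> nlinarith [sq_nonneg (F τ x - G τ x), sq_nonneg (F τ x + G τ x)]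
    have hswap := intervalIntegral_integral_swap (a := 0) (b := t) hIntg
    have hpt : ∀ x, ∫ τ in (0 : ℝ)..t, 2 * (F τ x * G τ x) = F t x ^ 2 - F 0 x ^ 2 := by
      intro x
      refine intervalIntegral.integral_eq_sub_of_hasDerivAt (f := fun τ => F τ x ^ 2) ?_ ?_
      · intro τ _
        refine ((hd τ x).pow 2).congr_deriv ?_
        simp; ring
      · exact (hcc.comp (continuous_id.prodMk continuous_const)).intervalIntegrable _ _
    simp only [hpt] at hswap
    simp only [integral_const_mul] at hswap
    rw [hswap, integral_sub (hF.2.1 t ht).2.2 (hF.2.1 0 ⟨le_refl _, hT.le⟩).2.2]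
    ring
  set e := fun t => 2 * ∫ x, F t x * G t x with he
  set e' : ℝ → ℝ := Set.IccExtend hT.le (Set.domRestrict (Icc 0 T) e) with he'
  have ce' : Continuous e' := (continuousOn_iff_continuous_domRestrict.1 hcont).Icc_extend'
  have hee : ∀ τ ∈ Icc 0 T, e' τ = e τ := fun τ hτ => by
    rw [he', Set.IccExtend_of_mem _ _ hτ]; rfl
  have hder : HasDerivAt (fun t => (∫ x, F 0 x ^ 2) + ∫ τ in (0 : ℝ)..t, e' τ) (e' t) t :=
    (intervalIntegral.integral_hasDerivAt_right (ce'.intervalIntegrable _ _)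
      (ce'.stronglyMeasurableAtFilter _ _) ce'.continuousAt).const_add _
  rw [hee t ht] at hder
  refine hder.hasDerivWithinAt.congr (fun y hy => ?_) ?_
  · rw [key y hy]
    congr 1
    refine intervalIntegral.integral_congr fun τ hτ => ?_
    rw [Set.uIcc_of_le hy.1] at hτ
    exact (hee τ ⟨hτ.1, hτ.2.trans hy.2⟩).symm
  · rw [key t ht]
    congr 1
    refine intervalIntegral.integral_congr fun τ hτ => ?_
    rw [Set.uIcc_of_le ht.1] at hτ
    exact (hee τ ⟨hτ.1, hτ.2.trans ht.2⟩).symm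

/-! Commutation of space and time derivatives. -/

lemma Sm.slice {F : ℝ → (Fin n → ℝ) → ℝ} (hF : Sm (Function.uncurry F)) (t : ℝ) : Sm (F t) :=
  hF.comp (contDiff_const.prodMk contDiff_id)

lemma pd_joint {F : ℝ → (Fin n → ℝ) → ℝ} (hF : Sm (Function.uncurry F)) (k : Fin n) (t : ℝ)
    (x : Fin n → ℝ) :
    pd k (F t) x = fderiv ℝ (Function.uncurry F) (t, x) (0, Pi.single k 1) := by
  have h1 : HasFDerivAt (fun y : Fin n → ℝ => (t, y))
      (ContinuousLinearMap.inr ℝ ℝ (Fin n → ℝ)) x := hasFDerivAt_prodMk_right t x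
  have h2 := ((hF.diff (t, x)).hasFDerivAt).comp x h1
  have h3 : HasFDerivAt (F t) _ x := h2
  simp only [pd]
  rw [h3.fderiv]
  simp

lemma hasDeriv_joint {F : ℝ → (Fin n → ℝ) → ℝ} (hF : Sm (Function.uncurry F)) (t : ℝ)
    (x : Fin n → ℝ) :
    HasDerivAt (fun τ => F τ x) (fderiv ℝ (Function.uncurry F) (t, x) (1, 0)) t := by
  have h1 : HasFDerivAt (fun τ : ℝ => (τ, x))
      (ContinuousLinearMap.inl ℝ ℝ (Fin n → ℝ)) t := hasFDerivAt_prodMk_left t x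
  have h2 := ((hF.diff (t, x)).hasFDerivAt).comp t h1
  have h3 : HasFDerivAt (fun τ => F τ x) _ t := h2
  have h4 := h3.hasDerivAt
  simpa using h4

lemma Sm.joint_pd {F : ℝ → (Fin n → ℝ) → ℝ} (hF : Sm (Function.uncurry F)) (k : Fin n) :
    Sm (Function.uncurry fun t => _root_.pd k (F t)) := by
  have : (Function.uncurry fun t => _root_.pd k (F t))
      = fun z => fderiv ℝ (Function.uncurry F) z (0, Pi.single k 1) := by
    funext ⟨t, x⟩
    exact pd_joint hF k t x
  rw [this]
  exact hF.dir _

lemma Sm.joint_Dw {F : ℝ → (Fin n → ℝ) → ℝ} (hF : Sm (Function.uncurry F)) (w : List (Fin n)) :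
    Sm (Function.uncurry fun t => _root_.Dw w (F t)) := by
  induction w with
  | nil => exact hF
  | cons k w ih => exact Sm.joint_pd ih k

lemma Sm.joint_dt {F : ℝ → (Fin n → ℝ) → ℝ} (hF : Sm (Function.uncurry F)) :
    Sm (Function.uncurry fun t x => deriv (fun τ => F τ x) t) := by
  have : (Function.uncurry fun t x => deriv (fun τ => F τ x) t)
      = fun z => fderiv ℝ (Function.uncurry F) z (1, 0) := by
    funext ⟨t, x⟩
    exact (hasDeriv_joint hF t x).deriv
  rw [this]
  exact hF.dir _

lemma dt_Dw {F : ℝ → (Fin n → ℝ) → ℝ} (hF : Sm (Function.uncurry F)) (w : List (Fin n)) (t : ℝ) :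
    (fun x => deriv (fun τ => Dw w (F τ) x) t) = Dw w (fun y => deriv (fun τ => F τ y) t) := by
  induction w with
  | nil => rfl
  | cons k w ih =>
    simp only [Dw]
    rw [← ih]
    have hH := Sm.joint_Dw hF w
    funext x
    have h1 := (hasDeriv_joint (Sm.joint_pd hH k) t x).deriv
    rw [h1]
    have h2 := pd_joint (Sm.joint_dt hH) k t x
    rw [h2]
    have e1 : (Function.uncurry fun t => pd k (Dw w (F t)))
        = fun z => fderiv ℝ (Function.uncurry fun t => Dw w (F t)) z (0, Pi.single k 1) := by
      funext ⟨t, x⟩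
      exact pd_joint hH k t x
    have e2 : (Function.uncurry fun t x => deriv (fun τ => Dw w (F τ) x) t)
        = fun z => fderiv ℝ (Function.uncurry fun t => Dw w (F t)) z (1, 0) := by
      funext ⟨t, x⟩
      exact (hasDeriv_joint hH t x).deriv
    rw [e1, e2]
    exact Sm.dir_comm hH _ _ _

lemma TC.Dw_mul {T : ℝ} {s : ℕ} {f g : ℝ → (Fin n → ℝ) → ℝ} (sf : ∀ t, Sm (f t))
    (sg : ∀ t, Sm (g t))
    (hf : ∀ v : List (Fin n), v.length ≤ s + 1 → TC T (fun t => Dw v (f t)))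
    (hg : ∀ v : List (Fin n), v.length ≤ s → TC T (fun t => Dw v (g t)))
    (w : List (Fin n)) (hw : w.length ≤ s) :
    TC T (fun t => Dw w (fun y => f t y * g t y)) := by
  obtain ⟨L, hL, h⟩ := leibniz w
  have h1 : TC T (fun t x => f t x * Dw w (g t) x
      + (L.map fun p => Dw p.1 (pd p.2.1 (f t)) x * Dw p.2.2 (g t) x).sum) := by
    refine TC.add ((hf [] (by simp)).mul (hg w hw)) ?_
    refine TC.lsum L (f := fun p t x => Dw p.1 (pd p.2.1 (f t)) x * Dw p.2.2 (g t) x)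
      fun p hp => ?_
    have hl := hL p hp
    refine TC.mul ?_ (hg _ (by omega))
    refine (hf (p.1 ++ [p.2.1]) (by simp; omega)).congr fun t _ => ?_
    rw [Dw_append]; rfl
  exact h1.congr fun t _ => (h (f t) (g t) (sf t) (sg t)).symm

end


/-! ### Part E: assembly -/

section
variable {n : ℕ}

lemma opnorm_le_sum {F : Type*} [NormedAddCommGroup F] [NormedSpace ℝ F]
    (L : (Fin n → ℝ) →L[ℝ] F) : ‖L‖ ≤ ∑ k, ‖L (Pi.single k 1)‖ := by
  refine L.opNorm_le_bound (Finset.sum_nonneg fun k _ => norm_nonneg _) fun x => ?_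
  have hx : x = ∑ k, x k • (Pi.single k (1 : ℝ) : Fin n → ℝ) := by
    funext i
    simp [Finset.sum_apply, Pi.single_apply]
  have h1 : L x = ∑ k, x k • L (Pi.single k 1) := by
    conv_lhs => rw [hx]
    rw [map_sum]
    simp only [map_smul]
  rw [h1, Finset.sum_mul]
  refine (norm_sum_le _ _).trans (Finset.sum_le_sum fun k _ => ?_)
  rw [norm_smul, mul_comm]
  exact mul_le_mul_of_nonneg_left (norm_le_pi_norm x k) (norm_nonneg _)

lemma le_opnorm_single {F : Type*} [NormedAddCommGroup F] [NormedSpace ℝ F]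
    (L : (Fin n → ℝ) →L[ℝ] F) (k : Fin n) : ‖L (Pi.single k 1)‖ ≤ ‖L‖ := by
  have := L.le_opNorm (Pi.single k (1 : ℝ))
  simpa [Pi.norm_single] using this

lemma word_hasDeriv {T : ℝ} (hT : 0 < T) {F H : ℝ → (Fin n → ℝ) → ℝ}
    (sF : Sm (Function.uncurry F)) (sH : ∀ t, Sm (H t)) (w : List (Fin n))
    (hF : TC T (fun t => Dw w (F t))) (hH : TC T (fun t => Dw w (H t)))
    (heq : ∀ t ∈ Icc 0 T, ∀ y, deriv (fun τ => F τ y) t = -H t y) {t : ℝ} (ht : t ∈ Icc 0 T) :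
    HasDerivWithinAt (fun t => ∫ x, Dw w (F t) x ^ 2) (-2 * ∫ x, Dw w (F t) x * Dw w (H t) x)
      (Icc 0 T) t := by
  have e : ∀ t ∈ Icc 0 T, (fun x => deriv (fun τ => Dw w (F τ) x) t)
      = fun x => (-1) * Dw w (H t) x := by
    intro t ht
    rw [dt_Dw sF, ← Dw_const_mul (sH t)]
    congr 1
    funext y
    rw [heq t ht]; ring
  have sD := Sm.joint_Dw sF w
  have hG : TC T (fun t x => deriv (fun τ => Dw w (F τ) x) t) :=
    (hH.cmul (-1)).congr fun t ht => (e t ht).symm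
  have := hF.hasDeriv hT hG sD.continuous (Sm.joint_dt sD).continuous
    (fun t x => (hasDeriv_joint sD t x).differentiableAt.hasDerivAt) ht
  refine this.congr_deriv ?_
  have e' : ∀ x, deriv (fun τ => Dw w (F τ) x) t = (-1) * Dw w (H t) x := fun x => congrFun (e t ht) x
  simp only [e']
  have e2 : (fun x => Dw w (F t) x * (-1 * Dw w (H t) x))
      = fun x => (-1) * (Dw w (F t) x * Dw w (H t) x) := by funext x; ring
  rw [e2, integral_const_mul]; ring

end

/-- A priori energy differential inequality for the symmetric hyperbolic system. -/
theorem symmetric_hyperbolic_energy_inequality :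
    ∀ n s : ℕ, 1 ≤ n → 1 ≤ s → ∀ γ : ℝ, 1 < γ →
    ∃ c : ℝ, 0 < c ∧
    ∀ rbar T : ℝ, 0 < rbar → 0 < T →
    ∀ (r : ℝ → (Fin n → ℝ) → ℝ) (u : ℝ → (Fin n → ℝ) → Fin n → ℝ),
      ContDiff ℝ (⊤ : ℕ∞) (Function.uncurry r) →
      ContDiff ℝ (⊤ : ℕ∞) (Function.uncurry u) →
      -- the symmetric hyperbolic system
      (∀ t ∈ Icc (0 : ℝ) T, ∀ x,
        deriv (fun τ => r τ x) t
          + ∑ i, u t x i * fderiv ℝ (r t) x (Pi.single i 1)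
          + (γ - 1) / 2 * r t x *
              ∑ i, fderiv ℝ (fun y => u t y i) x (Pi.single i 1) = 0) →
      (∀ t ∈ Icc (0 : ℝ) T, ∀ x, ∀ i : Fin n,
        deriv (fun τ => u τ x i) t
          + ∑ j, u t x j * fderiv ℝ (fun y => u t y i) x (Pi.single j 1)
          + r t x * fderiv ℝ (r t) x (Pi.single i 1) = 0) →
      -- boundedness of the derivatives of order ≤ s+1
      (∀ α ∈ multiIndices n (s + 1), ∃ C : ℝ, ∀ t ∈ Icc (0 : ℝ) T, ∀ x,
        |mderiv α (fun y => r t y - rbar) x| ≤ C ∧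
        ∀ i, |mderiv α (fun y => u t y i) x| ≤ C) →
      -- square-integrability in `x` for each `t`
      (∀ α ∈ multiIndices n (s + 1), ∀ t ∈ Icc (0 : ℝ) T,
        Integrable (fun x => mderiv α (fun y => r t y - rbar) x ^ 2) ∧
        ∀ i, Integrable (fun x => mderiv α (fun y => u t y i) x ^ 2)) →
      -- the derivatives depend continuously on `t` as maps into `L²(ℝⁿ)`
      (∀ α ∈ multiIndices n (s + 1),
        (∃ R : ℝ → Lp ℝ 2 (volume : Measure (Fin n → ℝ)),
          ContinuousOn R (Icc 0 T) ∧ ∀ t ∈ Icc (0 : ℝ) T,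
            (R t : (Fin n → ℝ) → ℝ) =ᵐ[volume] mderiv α (fun y => r t y - rbar)) ∧
        ∀ i : Fin n, ∃ U : ℝ → Lp ℝ 2 (volume : Measure (Fin n → ℝ)),
          ContinuousOn U (Icc 0 T) ∧ ∀ t ∈ Icc (0 : ℝ) T,
            (U t : (Fin n → ℝ) → ℝ) =ᵐ[volume] mderiv α (fun y => u t y i)) →
      -- conclusion: `E` is differentiable on `[0,T]` with
      -- `E'(t) ≤ c (‖∇u(t)‖_∞ + ‖∇r(t)‖_∞) E(t)`
      ∀ t ∈ Icc (0 : ℝ) T, ∃ E' : ℝ,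
        HasDerivWithinAt (En n s γ rbar r u) E' (Icc 0 T) t ∧
        E' ≤ c * ((⨆ x, ‖fderiv ℝ (u t) x‖) + ⨆ x, ‖fderiv ℝ (r t) x‖)
              * En n s γ rbar r u t := by
  intro n s hn hs γ hγ
  set κ : ℝ := (γ - 1) / 2 with hκdef
  have hκ : 0 < κ := by rw [hκdef]; linarith
  have hex : ∀ α : Fin n → ℕ, ∃ c : ℝ, 0 ≤ c ∧ (α ∈ multiIndices n s →
      ∀ (rbar : ℝ) (ρ r : (Fin n → ℝ) → ℝ) (u : Fin n → (Fin n → ℝ) → ℝ)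
      (M B : ℝ), 0 < M → Cls (s + 1) ρ → (∀ i, Cls (s + 1) (u i)) → Sm r →
      (∀ x, ρ x = r x - rbar) →
      (∀ k x, |pd k r x| ≤ M) → (∀ i k x, |pd k (u i) x| ≤ M) →
      (∀ v : List (Fin n), v.length ≤ s → ∫ x, Dw v ρ x ^ 2 ≤ B) →
      (∀ i, ∀ v : List (Fin n), v.length ≤ s → ∫ x, Dw v (u i) x ^ 2 ≤ B) →
      |∫ x, (Dw (wordOf α) ρ x * Dw (wordOf α)
            (fun y => ∑ j, (u j y * pd j r y + κ * (r y * pd j (u j) y))) x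
        + κ * ∑ i, Dw (wordOf α) (u i) x *
          Dw (wordOf α) (fun y => (∑ j, u j y * pd j (u i) y) + r y * pd i r y) x)|
        ≤ c * (M * B)) := by
    intro α
    by_cases hα : α ∈ multiIndices n s
    · obtain ⟨c, hc, h⟩ := energy_fixed s κ hκ (wordOf α)
        (by rw [length_wordOf]; exact mem_multiIndices.1 hα)
      exact ⟨c, hc, fun _ => h⟩
    · exact ⟨0, le_refl _, fun h => absurd h hα⟩
  choose c hc hest using hex
  have hsc : 0 ≤ ∑ α ∈ multiIndices n s, c α := Finset.sum_nonneg fun α _ => hc α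
  refine ⟨2 * (∑ α ∈ multiIndices n s, c α) * (1 + 1 / κ) + 1, by positivity, ?_⟩
  intro rbar T hrbar hT r u sr su pde1 pde2 hbdd hIntg hL2 t ht
  -- the unknowns
  set ρ : ℝ → (Fin n → ℝ) → ℝ := fun t y => r t y - rbar with hρdef
  set ui : Fin n → ℝ → (Fin n → ℝ) → ℝ := fun i t y => u t y i with huidef
  have sρ : Sm (Function.uncurry ρ) := sr.sub contDiff_const
  have sui : ∀ i, Sm (Function.uncurry (ui i)) := fun i => (contDiff_pi.1 su) i
  have srt : ∀ t, Sm (r t) := fun t => Sm.slice sr t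
  have sρt : ∀ t, Sm (ρ t) := fun t => Sm.slice sρ t
  have suit : ∀ i t, Sm (ui i t) := fun i t => Sm.slice (sui i) t
  have sut : ∀ t, Differentiable ℝ (u t) := fun t =>
    differentiable_pi.2 fun i => (suit i t).diff
  -- time continuity of all derivatives
  have tρ : ∀ v : List (Fin n), v.length ≤ s + 1 → TC T (fun t => Dw v (ρ t)) := by
    intro v hv
    obtain ⟨α, hα, hm⟩ := exists_multi v
    have hmem : α ∈ multiIndices n (s + 1) := mem_multiIndices.2 (hα.le.trans hv)
    have hm' : ∀ t, mderiv α (fun y => r t y - rbar) = Dw v (ρ t) := fun t => hm _ (sρt t)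
    obtain ⟨C, hC⟩ := hbdd α hmem
    obtain ⟨R, hR, hRe⟩ := (hL2 α hmem).1
    refine TC.of_Lp ⟨C, fun t ht x => ?_⟩ (fun t => ((sρt t).Dw v).continuous) (fun t ht => ?_) hR
      (fun t ht => ?_)
    · rw [← hm']; exact (hC t ht x).1
    · rw [← hm']; exact (hIntg α hmem t ht).1
    · rw [← hm']; exact hRe t ht
  have tu : ∀ i, ∀ v : List (Fin n), v.length ≤ s + 1 → TC T (fun t => Dw v (ui i t)) := by
    intro i v hv
    obtain ⟨α, hα, hm⟩ := exists_multi v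
    have hmem : α ∈ multiIndices n (s + 1) := mem_multiIndices.2 (hα.le.trans hv)
    have hm' : ∀ t, mderiv α (fun y => u t y i) = Dw v (ui i t) := fun t => hm _ (suit i t)
    obtain ⟨C, hC⟩ := hbdd α hmem
    obtain ⟨R, hR, hRe⟩ := (hL2 α hmem).2 i
    refine TC.of_Lp ⟨C, fun t ht x => ?_⟩ (fun t => ((suit i t).Dw v).continuous)
      (fun t ht => ?_) hR (fun t ht => ?_)
    · rw [← hm']; exact (hC t ht x).2 i
    · rw [← hm']; exact (hIntg α hmem t ht).2 i
    · rw [← hm']; exact hRe t ht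
  have hpdr : ∀ k t, pd k (r t) = pd k (ρ t) := fun k t => (pd_sub_const (r t) rbar k).symm
  have tρ' : ∀ k, ∀ v : List (Fin n), v.length ≤ s → TC T (fun t => Dw v (pd k (r t))) := by
    intro k v hv
    refine (tρ (k :: v) (by simp; omega)).congr fun t _ => ?_
    rw [hpdr, Dw_pd (sρt t)]; rfl
  have tu' : ∀ i k, ∀ v : List (Fin n), v.length ≤ s → TC T (fun t => Dw v (pd k (ui i t))) := by
    intro i k v hv
    refine (tu i (k :: v) (by simp; omega)).congr fun t _ => ?_
    rw [Dw_pd (suit i t)]; rfl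
  -- products
  have tr_mul : ∀ g : ℝ → (Fin n → ℝ) → ℝ, (∀ t, Sm (g t)) →
      (∀ v : List (Fin n), v.length ≤ s → TC T (fun t => Dw v (g t))) →
      ∀ w : List (Fin n), w.length ≤ s → TC T (fun t => Dw w (fun y => r t y * g t y)) := by
    intro g sg hg w hw
    refine ((TC.Dw_mul sρt sg tρ hg w hw).add ((hg w hw).cmul rbar)).congr fun t _ => ?_
    have e : (fun y => r t y * g t y) = fun y => ρ t y * g t y + rbar * g t y := by
      funext y; simp only [hρdef]; ring
    rw [e, Dw_add ((sρt t).mul (sg t)) (contDiff_const.mul (sg t)), Dw_const_mul (sg t)]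
  set HR : ℝ → (Fin n → ℝ) → ℝ := fun t y =>
    ∑ j, (ui j t y * pd j (r t) y + κ * (r t y * pd j (ui j t) y)) with hHR
  set HU : Fin n → ℝ → (Fin n → ℝ) → ℝ := fun i t y =>
    (∑ j, ui j t y * pd j (ui i t) y) + r t y * pd i (r t) y with hHU
  have s1 : ∀ t j, Sm (fun y => ui j t y * pd j (r t) y) := fun t j =>
    (suit j t).mul ((srt t).pd j)
  have s2 : ∀ t j, Sm (fun y => r t y * pd j (ui j t) y) := fun t j =>
    (srt t).mul ((suit j t).pd j)
  have s3 : ∀ t i j, Sm (fun y => ui j t y * pd j (ui i t) y) := fun t i j =>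
    (suit j t).mul ((suit i t).pd j)
  have s4 : ∀ t i, Sm (fun y => r t y * pd i (r t) y) := fun t i =>
    (srt t).mul ((srt t).pd i)
  have s12 : ∀ t j, Sm (fun y => ui j t y * pd j (r t) y + κ * (r t y * pd j (ui j t) y)) :=
    fun t j => (s1 t j).add (contDiff_const.mul (s2 t j))
  have sHR : ∀ t, Sm (HR t) := fun t => Sm.fsum (s12 t)
  have sHU : ∀ i t, Sm (HU i t) := fun i t => (Sm.fsum (s3 t i)).add (s4 t i)
  have tHR : ∀ w : List (Fin n), w.length ≤ s → TC T (fun t => Dw w (HR t)) := by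
    intro w hw
    refine (TC.fsum Finset.univ (f := fun j t x => Dw w (fun y => ui j t y * pd j (r t) y) x
      + κ * Dw w (fun y => r t y * pd j (ui j t) y) x) fun j => ?_).congr fun t _ => ?_
    · exact (TC.Dw_mul (suit j) (fun t => (srt t).pd j) (tu j) (tρ' j) w hw).add
        ((tr_mul (fun t => pd j (ui j t)) (fun t => (suit j t).pd j) (tu' j j) w hw).cmul κ)
    · rw [hHR, Dw_sum _ (s12 t)]
      funext x
      refine Finset.sum_congr rfl fun j _ => ?_
      rw [Dw_add (s1 t j) (contDiff_const.mul (s2 t j)), Dw_const_mul (s2 t j)]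
  have tHU : ∀ i, ∀ w : List (Fin n), w.length ≤ s → TC T (fun t => Dw w (HU i t)) := by
    intro i w hw
    refine ((TC.fsum Finset.univ (f := fun j t x => Dw w (fun y => ui j t y * pd j (ui i t) y) x)
      fun j => ?_).add
      (tr_mul (fun t => pd i (r t)) (fun t => (srt t).pd i) (tρ' i) w hw)).congr fun t _ => ?_
    · exact TC.Dw_mul (suit j) (fun t => (suit i t).pd j) (tu j) (tu' i j) w hw
    · rw [hHU, Dw_add (Sm.fsum (s3 t i)) (s4 t i), Dw_sum _ (s3 t i)]
  have eqR : ∀ t ∈ Icc 0 T, ∀ y, deriv (fun τ => ρ τ y) t = -HR t y := by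
    intro t ht y
    have h1 := pde1 t ht y
    have h2 : deriv (fun τ => ρ τ y) t = deriv (fun τ => r τ y) t := by
      simp only [hρdef, deriv_sub_const]
    have h3 : HR t y = ∑ i, u t y i * fderiv ℝ (r t) y (Pi.single i 1)
        + κ * r t y * ∑ i, fderiv ℝ (fun y => u t y i) y (Pi.single i 1) := by
      simp only [hHR]
      rw [Finset.sum_add_distrib, Finset.mul_sum]
      congr 1
      refine Finset.sum_congr rfl fun j _ => ?_
      simp only [pd, huidef]; ring
    rw [h2, h3]; linarith
  have eqU : ∀ i, ∀ t ∈ Icc 0 T, ∀ y, deriv (fun τ => ui i τ y) t = -HU i t y := by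
    intro i t ht y
    have h1 := pde2 t ht y i
    have h3 : HU i t y = ∑ j, u t y j * fderiv ℝ (fun y => u t y i) y (Pi.single j 1)
        + r t y * fderiv ℝ (r t) y (Pi.single i 1) := rfl
    have h4 : deriv (fun τ => ui i τ y) t = deriv (fun τ => u τ y i) t := rfl
    rw [h4, h3]; linarith
  -- the energy
  have hEn : ∀ t ∈ Icc 0 T, En n s γ rbar r u t = ∑ α ∈ multiIndices n s,
      ((∫ x, Dw (wordOf α) (ρ t) x ^ 2) + κ * ∑ i, ∫ x, Dw (wordOf α) (ui i t) x ^ 2) := by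
    intro t ht
    unfold En
    refine Finset.sum_congr rfl fun α hα => ?_
    have hl : (wordOf α).length ≤ s + 1 := by
      rw [length_wordOf]; exact (mem_multiIndices.1 hα).trans (Nat.le_succ s)
    have i1 := ((tρ _ hl).2.1 t ht).2.2
    have i2 := fun i => ((tu i _ hl).2.1 t ht).2.2
    rw [← integral_finsetSum _ fun i _ => i2 i, ← integral_const_mul,
      ← integral_add i1 ((integrable_finsetSum _ fun i _ => i2 i).const_mul κ)]
    simp only [mderiv_eq]
    rfl
  have hterm : ∀ t (α : Fin n → ℕ), 0 ≤ (∫ x, Dw (wordOf α) (ρ t) x ^ 2)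
      + κ * ∑ i, ∫ x, Dw (wordOf α) (ui i t) x ^ 2 := fun t α =>
    add_nonneg (integral_nonneg fun x => sq_nonneg _) (mul_nonneg hκ.le
      (Finset.sum_nonneg fun i _ => integral_nonneg fun x => sq_nonneg _))
  set E := En n s γ rbar r u t with hE
  have hE0 : 0 ≤ E := by
    rw [hE, hEn t ht]; exact Finset.sum_nonneg fun α _ => hterm t α
  have hleE : ∀ v : List (Fin n), v.length ≤ s → (∫ x, Dw v (ρ t) x ^ 2)
      + κ * ∑ i, ∫ x, Dw v (ui i t) x ^ 2 ≤ E := by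
    intro v hv
    obtain ⟨α, hα, hm⟩ := exists_multi v
    have hmem : α ∈ multiIndices n s := mem_multiIndices.2 (hα.le.trans hv)
    rw [hE, hEn t ht]
    have := Finset.single_le_sum (f := fun α => (∫ x, Dw (wordOf α) (ρ t) x ^ 2)
      + κ * ∑ i, ∫ x, Dw (wordOf α) (ui i t) x ^ 2) (fun α _ => hterm t α) hmem
    refine le_trans (le_of_eq ?_) this
    simp only [← mderiv_eq, hm _ (sρt t), hm _ (suit _ t)]
  have hBρ : ∀ v : List (Fin n), v.length ≤ s → ∫ x, Dw v (ρ t) x ^ 2 ≤ (1 + 1 / κ) * E := by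
    intro v hv
    have h1 := hleE v hv
    have h2 : 0 ≤ κ * ∑ i, ∫ x, Dw v (ui i t) x ^ 2 := mul_nonneg hκ.le
      (Finset.sum_nonneg fun i _ => integral_nonneg fun x => sq_nonneg _)
    have h3 : 0 ≤ 1 / κ * E := by positivity
    linarith
  have hBu : ∀ i, ∀ v : List (Fin n), v.length ≤ s →
      ∫ x, Dw v (ui i t) x ^ 2 ≤ (1 + 1 / κ) * E := by
    intro i v hv
    have h1 := hleE v hv
    have h0 : 0 ≤ ∫ x, Dw v (ρ t) x ^ 2 := integral_nonneg fun x => sq_nonneg _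
    have h2 : ∫ x, Dw v (ui i t) x ^ 2 ≤ ∑ i, ∫ x, Dw v (ui i t) x ^ 2 :=
      Finset.single_le_sum (f := fun i => ∫ x, Dw v (ui i t) x ^ 2)
        (fun i _ => integral_nonneg fun x => sq_nonneg _) (Finset.mem_univ i)
    have h3 : κ * ∫ x, Dw v (ui i t) x ^ 2 ≤ E := by
      have := mul_le_mul_of_nonneg_left h2 hκ.le
      linarith
    have h4 : ∫ x, Dw v (ui i t) x ^ 2 ≤ 1 / κ * E := by
      rw [one_div, ← div_eq_inv_mul, le_div_iff₀ hκ]; linarith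
    linarith
  -- gradient bounds
  have cr : ∀ k, ∃ C, ∀ x, |pd k (r t) x| ≤ C := fun k => by
    obtain ⟨C, _, hC⟩ := (tρ' k [] (by simp)).1
    exact ⟨C, fun x => hC t ht x⟩
  have cu : ∀ i k, ∃ C, ∀ x, |pd k (ui i t) x| ≤ C := fun i k => by
    obtain ⟨C, _, hC⟩ := (tu' i k [] (by simp)).1
    exact ⟨C, fun x => hC t ht x⟩
  choose Cr hCr using cr
  choose Cu hCu using cu
  have comp : ∀ x v i, fderiv ℝ (u t) x v i = fderiv ℝ (ui i t) x v := by
    intro x v i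
    have h1 := (hasFDerivAt_pi'.1 (sut t x).hasFDerivAt) i
    have h2 : fderiv ℝ (ui i t) x = _ := h1.fderiv
    rw [h2]; rfl
  have bddr : BddAbove (Set.range fun x => ‖fderiv ℝ (r t) x‖) := by
    refine ⟨∑ k, Cr k, ?_⟩
    rintro _ ⟨x, rfl⟩
    exact (opnorm_le_sum _).trans (Finset.sum_le_sum fun k _ => hCr k x)
  have bddu : BddAbove (Set.range fun x => ‖fderiv ℝ (u t) x‖) := by
    refine ⟨∑ k, ∑ i, |Cu i k|, ?_⟩
    rintro _ ⟨x, rfl⟩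
    refine (opnorm_le_sum _).trans (Finset.sum_le_sum fun k _ => ?_)
    refine (pi_norm_le_iff_of_nonneg (Finset.sum_nonneg fun i _ => abs_nonneg _)).2 fun i => ?_
    rw [comp]
    refine ((hCu i k x).trans (le_abs_self _)).trans ?_
    exact Finset.single_le_sum (f := fun i => |Cu i k|) (fun i _ => abs_nonneg _)
      (Finset.mem_univ i)
  set A := (⨆ x, ‖fderiv ℝ (u t) x‖) + ⨆ x, ‖fderiv ℝ (r t) x‖ with hA
  have hAu0 : 0 ≤ ⨆ x, ‖fderiv ℝ (u t) x‖ := Real.iSup_nonneg fun x => norm_nonneg _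
  have hAr0 : 0 ≤ ⨆ x, ‖fderiv ℝ (r t) x‖ := Real.iSup_nonneg fun x => norm_nonneg _
  have hA0 : 0 ≤ A := add_nonneg hAu0 hAr0
  have hAr : ∀ k x, |pd k (r t) x| ≤ A := by
    intro k x
    have h1 : |pd k (r t) x| ≤ ‖fderiv ℝ (r t) x‖ :=
      le_opnorm_single (fderiv ℝ (r t) x) k
    have h2 : ‖fderiv ℝ (r t) x‖ ≤ ⨆ x, ‖fderiv ℝ (r t) x‖ := le_ciSup bddr x
    linarith
  have hAu : ∀ i k x, |pd k (ui i t) x| ≤ A := by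
    intro i k x
    have h0 := norm_le_pi_norm (fderiv ℝ (u t) x (Pi.single k 1)) i
    rw [comp] at h0
    have h0' : |pd k (ui i t) x| ≤ ‖fderiv ℝ (u t) x (Pi.single k 1)‖ := h0
    have h1 := le_opnorm_single (fderiv ℝ (u t) x) k
    have h2 : ‖fderiv ℝ (u t) x‖ ≤ ⨆ x, ‖fderiv ℝ (u t) x‖ := le_ciSup bddu x
    linarith
  have clsρ : Cls (s + 1) (ρ t) := ⟨sρt t, fun w hw => (tρ w hw).2.1 t ht⟩
  have clsu : ∀ i, Cls (s + 1) (ui i t) := fun i => ⟨suit i t, fun w hw => (tu i w hw).2.1 t ht⟩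
  -- the derivative
  refine ⟨∑ α ∈ multiIndices n s, ((-2 * ∫ x, Dw (wordOf α) (ρ t) x * Dw (wordOf α) (HR t) x)
    + κ * ∑ i, (-2 * ∫ x, Dw (wordOf α) (ui i t) x * Dw (wordOf α) (HU i t) x)), ?_, ?_⟩
  · have hder : HasDerivWithinAt (fun t => ∑ α ∈ multiIndices n s,
        ((∫ x, Dw (wordOf α) (ρ t) x ^ 2) + κ * ∑ i, ∫ x, Dw (wordOf α) (ui i t) x ^ 2))
        (∑ α ∈ multiIndices n s, ((-2 * ∫ x, Dw (wordOf α) (ρ t) x * Dw (wordOf α) (HR t) x)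
    + κ * ∑ i, (-2 * ∫ x, Dw (wordOf α) (ui i t) x * Dw (wordOf α) (HU i t) x))) (Icc 0 T) t := by
      refine HasDerivWithinAt.fun_sum fun α hα => ?_
      have hl : (wordOf α).length ≤ s := by
        rw [length_wordOf]; exact mem_multiIndices.1 hα
      refine (word_hasDeriv hT sρ sHR _ (tρ _ (by omega)) (tHR _ hl) eqR ht).add ?_
      refine HasDerivWithinAt.const_mul κ ?_
      refine HasDerivWithinAt.fun_sum fun i _ => ?_
      exact word_hasDeriv hT (sui i) (sHU i) _ (tu i _ (by omega)) (tHU i _ hl) (eqU i) ht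
    exact hder.congr (fun y hy => hEn y hy) (hEn t ht)
  · have hbound : ∀ ε : ℝ, 0 < ε → ∑ α ∈ multiIndices n s,
        ((-2 * ∫ x, Dw (wordOf α) (ρ t) x * Dw (wordOf α) (HR t) x)
        + κ * ∑ i, (-2 * ∫ x, Dw (wordOf α) (ui i t) x * Dw (wordOf α) (HU i t) x)) ≤
        2 * (∑ α ∈ multiIndices n s, c α) * (1 + 1 / κ) * (A + ε) * E := by
      intro ε hε
      have e : 2 * (∑ α ∈ multiIndices n s, c α) * (1 + 1 / κ) * (A + ε) * E
          = ∑ α ∈ multiIndices n s, 2 * (c α * ((A + ε) * ((1 + 1 / κ) * E))) := by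
        rw [← Finset.mul_sum, ← Finset.sum_mul]; ring
      rw [e]
      refine Finset.sum_le_sum fun α hα => ?_
      have hl : (wordOf α).length ≤ s := by
        rw [length_wordOf]; exact mem_multiIndices.1 hα
      have key := hest α hα rbar (ρ t) (r t) (fun i => ui i t) (A + ε) ((1 + 1 / κ) * E)
        (by linarith) clsρ clsu (srt t) (fun x => rfl)
        (fun k x => (hAr k x).trans (by linarith)) (fun i k x => (hAu i k x).trans (by linarith))
        hBρ hBu
      have i1 : Integrable (fun x => Dw (wordOf α) (ρ t) x * Dw (wordOf α) (HR t) x) :=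
        ((tρ _ (by omega)).2.1 t ht).mul_int ((tHR _ hl).2.1 t ht)
      have i2 : ∀ i, Integrable (fun x => Dw (wordOf α) (ui i t) x * Dw (wordOf α) (HU i t) x) :=
        fun i => ((tu i _ (by omega)).2.1 t ht).mul_int ((tHU i _ hl).2.1 t ht)
      have hsplit : ∫ x, (Dw (wordOf α) (ρ t) x * Dw (wordOf α) (HR t) x
          + κ * ∑ i, Dw (wordOf α) (ui i t) x * Dw (wordOf α) (HU i t) x)
          = (∫ x, Dw (wordOf α) (ρ t) x * Dw (wordOf α) (HR t) x)
          + κ * ∑ i, ∫ x, Dw (wordOf α) (ui i t) x * Dw (wordOf α) (HU i t) x := by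
        rw [integral_add i1 ((integrable_finsetSum _ fun i _ => i2 i).const_mul κ),
          integral_const_mul, integral_finsetSum _ fun i _ => i2 i]
      have key' : |∫ x, (Dw (wordOf α) (ρ t) x * Dw (wordOf α) (HR t) x
          + κ * ∑ i, Dw (wordOf α) (ui i t) x * Dw (wordOf α) (HU i t) x)|
          ≤ c α * ((A + ε) * ((1 + 1 / κ) * E)) := key
      rw [hsplit] at key'
      have h1 := (abs_le.1 key').1
      rw [← Finset.mul_sum]
      linarith
    have hlim : ∑ α ∈ multiIndices n s,
        ((-2 * ∫ x, Dw (wordOf α) (ρ t) x * Dw (wordOf α) (HR t) x)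
        + κ * ∑ i, (-2 * ∫ x, Dw (wordOf α) (ui i t) x * Dw (wordOf α) (HU i t) x)) ≤
        2 * (∑ α ∈ multiIndices n s, c α) * (1 + 1 / κ) * A * E := by
      refine le_of_forall_pos_le_add fun δ hδ => ?_
      set Z := 2 * (∑ α ∈ multiIndices n s, c α) * (1 + 1 / κ) * E with hZ
      have hZ0 : 0 ≤ Z := by positivity
      have := hbound (δ / (Z + 1)) (by positivity)
      refine this.trans ?_
      have e1 : 2 * (∑ α ∈ multiIndices n s, c α) * (1 + 1 / κ) * (A + δ / (Z + 1)) * E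
          = 2 * (∑ α ∈ multiIndices n s, c α) * (1 + 1 / κ) * A * E + Z * (δ / (Z + 1)) := by
        rw [hZ]; ring
      rw [e1]
      have e2 : Z * (δ / (Z + 1)) ≤ δ := by
        rw [← mul_div_assoc, div_le_iff₀ (by positivity)]
        nlinarith
      linarith
    refine hlim.trans ?_
    have h1 : 0 ≤ A * E := mul_nonneg hA0 hE0
    nlinarith
end

section
/- Uniqueness for the symmetric hyperbolic system: let n ≥ 1 be an integer, γ > 1, r̄ > 0 and T > 0. For i = 1, 2 let r_i : [0,T] × ℝⁿ → ℝ and u_i : [0,T] × ℝⁿ → ℝⁿ be continuously differentiable and satisfy pointwise on [0,T] × ℝⁿ the equations ∂_t r_i + u_i·∇_x r_i + ((γ−1)/2) r_i div_x u_i = 0 and ∂_t u_i + (u_i·∇_x)u_i + r_i ∇_x r_i = 0. Assume that r_i, u_i and their first spatial derivatives are bounded on [0,T] × ℝⁿ, that r_i − r̄ and u_i together with their first spatial derivatives are square-integrable in x for each t, and that t ↦ (r_i(t,·) − r̄, u_i(t,·)) is continuously differentiable as a map into L²(ℝⁿ). If r_1(0,·) = r_2(0,·) and u_1(0,·) = u_2(0,·)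 on ℝⁿ, then r_1 = r_2 and u_1 = u_2 on all of [0,T] × ℝⁿ. -/
open MeasureTheory Set

/-- A positive, integrable, smooth weight whose derivatives are controlled by itself. -/
lemma exists_weight (n : ℕ) (hn : 1 ≤ n) : ∃ φ : (Fin n → ℝ) → ℝ, ContDiff ℝ 1 φ ∧ (∀ x, 0 < φ x) ∧
    Integrable φ ∧ ∃ A : ℝ, 0 ≤ A ∧
      ∀ (j : Fin n) x, |fderiv ℝ φ x (Pi.single j 1)| ≤ A * φ x := by
  have hq : ∀ x : Fin n → ℝ, 0 ≤ ∑ i, x i ^ 2 := fun x => Finset.sum_nonneg fun i _ => sq_nonneg _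
  have hc : ContDiff ℝ 1 (fun x : Fin n → ℝ => ((1 + ∑ i, x i ^ 2) ^ n)⁻¹) := by
    apply ContDiff.inv
    · fun_prop
    · intro x; have := hq x; positivity
  refine ⟨fun x => ((1 + ∑ i, x i ^ 2) ^ n)⁻¹, hc, ?_, ?_, n, by positivity, ?_⟩
  · intro x; have := hq x; positivity
  · have h1 := integrable_rpow_neg_one_add_norm_sq (E := Fin n → ℝ) (μ := volume) (r := 2 * n)
      (by
        rw [Module.finrank_fin_fun]
        have : (1 : ℝ) ≤ n := by exact_mod_cast hn
        linarith)
    refine h1.mono' hc.continuous.aestronglyMeasurable (Filter.Eventually.of_forall fun x => ?_)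
    have hx := hq x
    rw [Real.norm_of_nonneg (by positivity),
      show (-(2 * (n : ℝ)) / 2) = -(n : ℝ) by ring, Real.rpow_neg (by positivity),
      Real.rpow_natCast]
    have hle : ‖x‖ ^ 2 ≤ ∑ i, x i ^ 2 := by
      have : ‖x‖ ≤ Real.sqrt (∑ i, x i ^ 2) := by
        rw [pi_norm_le_iff_of_nonneg (Real.sqrt_nonneg _)]
        intro i
        apply Real.le_sqrt_of_sq_le
        rw [Real.norm_eq_abs, sq_abs]
        exact Finset.single_le_sum (f := fun i => x i ^ 2) (fun i _ => sq_nonneg _)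
          (Finset.mem_univ i)
      calc ‖x‖ ^ 2 ≤ (Real.sqrt (∑ i, x i ^ 2)) ^ 2 := by gcongr
        _ = _ := Real.sq_sqrt hx
    gcongr
  · intro j x
    have hx := hq x
    have hsum : HasFDerivAt (fun x : Fin n → ℝ => ∑ i, x i ^ 2)
        (∑ i, ((2 * x i) • (ContinuousLinearMap.proj i : (Fin n → ℝ) →L[ℝ] ℝ))) x := by
      apply HasFDerivAt.fun_sum
      intro i _
      have h1 : HasFDerivAt (fun x : Fin n → ℝ => x i)
        (ContinuousLinearMap.proj i : (Fin n → ℝ) →L[ℝ] ℝ) x := hasFDerivAt_apply i x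
      simpa using h1.pow 2
    have hg : HasDerivAt (fun y : ℝ => ((1 + y) ^ n)⁻¹)
        (-((n : ℝ) * (1 + ∑ i, x i ^ 2) ^ (n - 1)) / ((1 + ∑ i, x i ^ 2) ^ n) ^ 2)
        (∑ i, x i ^ 2) := by
      have h2 : HasDerivAt (fun y : ℝ => (1 + y) ^ n)
        ((n : ℝ) * (1 + ∑ i, x i ^ 2) ^ (n - 1)) (∑ i, x i ^ 2) := by
        simpa using ((hasDerivAt_id' (∑ i, x i ^ 2)).const_add 1).fun_pow n
      exact h2.fun_inv (by positivity)
    have h3 := hg.comp_hasFDerivAt x hsum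
    have h4 : fderiv ℝ (fun x : Fin n → ℝ => ((1 + ∑ i, x i ^ 2) ^ n)⁻¹) x = _ := h3.fderiv
    rw [h4]
    simp only [smul_apply, sum_apply,
      ContinuousLinearMap.proj_apply, smul_eq_mul]
    have h5 : ∑ i, 2 * x i * (Pi.single j (1 : ℝ) : Fin n → ℝ) i = 2 * x j := by
      simp [Pi.single_apply]
    rw [h5]
    set q := ∑ i, x i ^ 2 with hqd
    have hj : x j ^ 2 ≤ q :=
      Finset.single_le_sum (f := fun i => x i ^ 2) (fun i _ => sq_nonneg _) (Finset.mem_univ j)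
    have h6 : |2 * x j| ≤ 1 + q := by
      rw [abs_le]; constructor <;> nlinarith [sq_nonneg (x j - 1), sq_nonneg (x j + 1)]
    have hpos : 0 < 1 + q := by linarith
    obtain ⟨m, rfl⟩ : ∃ m, n = m + 1 := ⟨n - 1, by omega⟩
    rw [abs_mul, abs_div, abs_neg, abs_of_nonneg (a := ((m + 1 : ℕ) : ℝ) * _) (by positivity),
      abs_of_nonneg (a := ((1 + q) ^ (m + 1)) ^ 2) (by positivity)]
    calc _ ≤ ((m + 1 : ℕ) : ℝ) * (1 + q) ^ (m + 1 - 1) / ((1 + q) ^ (m + 1)) ^ 2 * (1 + q) := by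
          gcongr
      _ = _ := by
          simp only [Nat.add_sub_cancel]
          field_simp
          ring

lemma integrable_weight_mul {n : ℕ} {φ f : (Fin n → ℝ) → ℝ} (hφ : Integrable φ)
    (hf : Continuous f) {B : ℝ} (hB : ∀ x, |f x| ≤ B) : Integrable (fun x => φ x * f x) := by
  refine (hφ.norm.const_mul B).mono' (hφ.aestronglyMeasurable.mul hf.aestronglyMeasurable)
    (Filter.Eventually.of_forall fun x => ?_)
  rw [norm_mul, mul_comm]
  have := hB x
  gcongr
  exact this

lemma gronwall_zero {T K : ℝ} {E E' : ℝ → ℝ} (hc : ContinuousOn E (Icc 0 T))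
    (hd : ∀ t ∈ Ioo 0 T, HasDerivAt E (E' t) t) (hle : ∀ t ∈ Ioo 0 T, E' t ≤ K * E t)
    (h0 : E 0 = 0) : ∀ t ∈ Icc 0 T, E t ≤ 0 := by
  have hd' : ∀ t ∈ Ioo 0 T, HasDerivAt (fun t => Real.exp (-K * t) * E t)
      (Real.exp (-K * t) * (-K * 1) * E t + Real.exp (-K * t) * E' t) t := fun t ht =>
    (((hasDerivAt_id t).const_mul (-K)).exp).mul (hd t ht)
  have hanti : AntitoneOn (fun t => Real.exp (-K * t) * E t) (Icc 0 T) := by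
    apply antitoneOn_of_deriv_nonpos (convex_Icc 0 T)
    · exact ContinuousOn.mul (by fun_prop) hc
    · rw [interior_Icc]
      exact fun t ht => (hd' t ht).differentiableAt.differentiableWithinAt
    · rw [interior_Icc]
      intro t ht
      rw [(hd' t ht).deriv]
      have := hle t ht
      have hp := Real.exp_pos (-K * t)
      nlinarith
  intro t ht
  have := hanti ⟨le_refl 0, ht.1.trans ht.2⟩ ht ht.1
  simp only [h0, mul_zero] at this
  exact nonpos_of_mul_nonpos_right this (Real.exp_pos _)

/-- Weighted energy method: a nonnegative bounded density with a flux controlled by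
the density vanishes if it vanishes initially. -/
lemma energy_zero {n : ℕ} (hn : 1 ≤ n) {T : ℝ}
    (e : ℝ → (Fin n → ℝ) → ℝ) (F : Fin n → ℝ → (Fin n → ℝ) → ℝ)
    (he : ContDiff ℝ 1 (Function.uncurry e)) (hF : ∀ j t, ContDiff ℝ 1 (F j t))
    (hpos : ∀ t x, 0 ≤ e t x)
    (B K L : ℝ) (hL : 0 ≤ L)
    (hBe : ∀ t ∈ Icc 0 T, ∀ x, |e t x| ≤ B)
    (hBt : ∀ t ∈ Icc 0 T, ∀ x, |deriv (fun s => e s x) t| ≤ B)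
    (hBD : ∀ j, ∃ B', ∀ t ∈ Icc 0 T, ∀ x, |fderiv ℝ (F j t) x (Pi.single j 1)| ≤ B')
    (hK : ∀ t ∈ Icc 0 T, ∀ x, deriv (fun s => e s x) t
      + ∑ j, fderiv ℝ (F j t) x (Pi.single j 1) ≤ K * e t x)
    (hFL : ∀ j, ∀ t ∈ Icc 0 T, ∀ x, |F j t x| ≤ L * e t x)
    (h0 : ∀ x, e 0 x = 0) : ∀ t ∈ Icc 0 T, ∀ x, e t x = 0 := by
  obtain ⟨φ, hφc, hφp, hφi, A, hA, hφA⟩ := exists_weight n hn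
  have hex : ∀ t, Continuous (e t) := fun t => he.continuous.comp (f := fun x : Fin n → ℝ => (t, x)) (by fun_prop)
  have hed : ∀ t x, HasDerivAt (fun s => e s x) (fderiv ℝ (Function.uncurry e) (t, x) (1, 0)) t := by
    intro t x
    have h1 : HasFDerivAt (Function.uncurry e) (fderiv ℝ (Function.uncurry e) (t, x)) (t, x) :=
      ((he.differentiable (by norm_num)) (t, x)).hasFDerivAt
    have h2 : HasDerivAt (fun s : ℝ => (s, x)) ((1 : ℝ), (0 : Fin n → ℝ)) t :=
      (hasDerivAt_id t).prodMk (hasDerivAt_const t x)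
    exact h1.comp_hasDerivAt t h2
  have hetc : ∀ t, Continuous (fun x => deriv (fun s => e s x) t) := by
    intro t
    have : (fun x => deriv (fun s => e s x) t) =
        fun x => fderiv ℝ (Function.uncurry e) (t, x) (1, 0) := funext fun x => (hed t x).deriv
    rw [this]
    have h1 := he.continuous_fderiv (by norm_num)
    have h2 : Continuous fun x : Fin n → ℝ => fderiv ℝ (Function.uncurry e) (t, x) :=
      h1.comp (by fun_prop)
    exact h2.clm_apply continuous_const
  have hIe : ∀ t ∈ Icc 0 T, Integrable (fun x => φ x * e t x) := fun t ht =>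
    integrable_weight_mul hφi (hex t) (hBe t ht)
  have hIt : ∀ t ∈ Icc 0 T, Integrable (fun x => φ x * deriv (fun s => e s x) t) := fun t ht =>
    integrable_weight_mul hφi (hetc t) (hBt t ht)
  have hFDc : ∀ j t, Continuous fun x => fderiv ℝ (F j t) x (Pi.single j 1) := fun j t =>
    ((hF j t).continuous_fderiv (by norm_num)).clm_apply continuous_const
  have hφDc : ∀ j, Continuous fun x => fderiv ℝ φ x (Pi.single j 1) := fun j =>
    (hφc.continuous_fderiv (by norm_num)).clm_apply continuous_const
  have hID : ∀ j, ∀ t ∈ Icc 0 T,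
      Integrable (fun x => φ x * fderiv ℝ (F j t) x (Pi.single j 1)) := fun j t ht => by
    obtain ⟨B', hB'⟩ := hBD j
    exact integrable_weight_mul hφi (hFDc j t) (hB' t ht)
  have hIF : ∀ j, ∀ t ∈ Icc 0 T, Integrable (fun x => φ x * F j t x) := fun j t ht =>
    integrable_weight_mul hφi (hF j t).continuous (B := L * B) fun x => by
      refine (hFL j t ht x).trans ?_
      have := (le_abs_self _).trans (hBe t ht x)
      gcongr
  have hbd : ∀ j, ∀ t ∈ Icc 0 T, ∀ x, |fderiv ℝ φ x (Pi.single j 1) * F j t x| ≤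
      (A * L) * (φ x * e t x) := by
    intro j t ht x
    rw [abs_mul]
    have h1 := hφA j x
    have h2 := hFL j t ht x
    have h3 := (hφp x).le
    calc _ ≤ (A * φ x) * (L * e t x) := by gcongr
      _ = _ := by ring
  have hIφ : ∀ j, ∀ t ∈ Icc 0 T,
      Integrable (fun x => fderiv ℝ φ x (Pi.single j 1) * F j t x) := fun j t ht => by
    refine ((hIe t ht).const_mul (A * L)).mono'
      ((hφDc j).mul (hF j t).continuous).aestronglyMeasurable
      (Filter.Eventually.of_forall (hbd j t ht))
  have hibp : ∀ j, ∀ t ∈ Icc 0 T, -∫ x, φ x * fderiv ℝ (F j t) x (Pi.single j 1) ≤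
      (A * L) * ∫ x, φ x * e t x := by
    intro j t ht
    rw [integral_mul_fderiv_eq_neg_fderiv_mul_of_integrable (hIφ j t ht) (hID j t ht) (hIF j t ht)
      (fun x _ => hφc.differentiable (by norm_num) x)
      (fun x _ => (hF j t).differentiable (by norm_num) x), neg_neg, ← integral_const_mul]
    exact integral_mono (hIφ j t ht) ((hIe t ht).const_mul _)
      fun x => (le_abs_self _).trans (hbd j t ht x)
  have hE' : ∀ t ∈ Icc 0 T, ∫ x, φ x * deriv (fun s => e s x) t ≤
      (K + n * (A * L)) * ∫ x, φ x * e t x := by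
    intro t ht
    have h1 : ∫ x, (φ x * deriv (fun s => e s x) t
        + ∑ j, φ x * fderiv ℝ (F j t) x (Pi.single j 1)) ≤ ∫ x, K * (φ x * e t x) := by
      refine integral_mono ((hIt t ht).add (integrable_finsetSum _ fun j _ => hID j t ht))
        ((hIe t ht).const_mul _) fun x => ?_
      have := mul_le_mul_of_nonneg_left (hK t ht x) (hφp x).le
      rw [mul_add, Finset.mul_sum] at this
      simp only
      linarith
    rw [integral_add (hIt t ht) (integrable_finsetSum _ fun j _ => hID j t ht),
      integral_finsetSum _ (fun j _ => hID j t ht), integral_const_mul] at h1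
    have h2 : ∑ j, -∫ x, φ x * fderiv ℝ (F j t) x (Pi.single j 1) ≤
        ∑ _j : Fin n, (A * L) * ∫ x, φ x * e t x := Finset.sum_le_sum fun j _ => hibp j t ht
    rw [Finset.sum_neg_distrib] at h2
    simp only [Finset.sum_const, Finset.card_univ, Fintype.card_fin, nsmul_eq_mul] at h2
    linarith
  have hcont : ContinuousOn (fun t => ∫ x, φ x * e t x) (Icc 0 T) := by
    refine continuousOn_of_dominated (bound := fun x => φ x * B)
      (fun t ht => (hIe t ht).aestronglyMeasurable) ?_ (hφi.mul_const B) ?_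
    · intro t ht
      refine Filter.Eventually.of_forall fun x => ?_
      rw [norm_mul, Real.norm_of_nonneg (hφp x).le]
      exact mul_le_mul_of_nonneg_left (hBe t ht x) (hφp x).le
    · refine Filter.Eventually.of_forall fun x => Continuous.continuousOn ?_
      exact continuous_const.mul (he.continuous.comp (f := fun t : ℝ => (t, x)) (by fun_prop))
  have hderiv : ∀ t ∈ Ioo 0 T, HasDerivAt (fun t => ∫ x, φ x * e t x)
      (∫ x, φ x * deriv (fun s => e s x) t) t := by
    intro t ht
    refine (hasDerivAt_integral_of_dominated_loc_of_deriv_le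
      (F := fun t x => φ x * e t x) (F' := fun t x => φ x * deriv (fun s => e s x) t)
      (bound := fun x => φ x * B)
      (Ioo_mem_nhds ht.1 ht.2) ?_ (hIe t (Ioo_subset_Icc_self ht))
      (hIt t (Ioo_subset_Icc_self ht)).aestronglyMeasurable ?_ (hφi.mul_const B) ?_).2
    · exact Filter.Eventually.of_forall fun t =>
        (hφc.continuous.mul (hex t)).aestronglyMeasurable
    · refine Filter.Eventually.of_forall fun x t ht => ?_
      rw [norm_mul, Real.norm_of_nonneg (hφp x).le]
      exact mul_le_mul_of_nonneg_left (hBt t (Ioo_subset_Icc_self ht) x) (hφp x).le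
    · refine Filter.Eventually.of_forall fun x t ht => ?_
      exact ((hed t x).differentiableAt.hasDerivAt).const_mul (φ x)
  have hg := gronwall_zero hcont hderiv (fun t ht => hE' t (Ioo_subset_Icc_self ht)) (by simp [h0])
  intro t ht x
  by_contra hne
  have := integral_pos_of_integrable_nonneg_nonzero (μ := volume)
    (hφc.continuous.mul (hex t)) (hIe t ht)
    (fun x => mul_nonneg (hφp x).le (hpos t x)) (x := x) (mul_ne_zero (hφp x).ne' hne)
  exact absurd (hg t ht) (not_le.mpr this)

lemma energy_algebra {n : ℕ} (κ r1 r2 r1t r2t : ℝ) (u1 u2 u1t u2t P1 P2 : Fin n → ℝ)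
    (G1 G2 : Fin n → Fin n → ℝ)
    (h1 : r1t + ∑ j, u1 j * P1 j + κ * r1 * ∑ j, G1 j j = 0)
    (h2 : r2t + ∑ j, u2 j * P2 j + κ * r2 * ∑ j, G2 j j = 0)
    (h3 : ∀ k, u1t k + ∑ j, u1 j * G1 k j + r1 * P1 k = 0)
    (h4 : ∀ k, u2t k + ∑ j, u2 j * G2 k j + r2 * P2 k = 0) (e : ℝ) :
    (2 * (r1 - r2) * (r1t - r2t) + κ * ∑ k, 2 * (u1 k - u2 k) * (u1t k - u2t k))
      + ∑ j, (G1 j j * e + u1 j * (2 * (r1 - r2) * (P1 j - P2 j)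
          + κ * ∑ k, 2 * (u1 k - u2 k) * (G1 k j - G2 k j))
        + 2 * κ * (P1 j * (r1 - r2) * (u1 j - u2 j) + r1 * (P1 j - P2 j) * (u1 j - u2 j)
          + r1 * (r1 - r2) * (G1 j j - G2 j j)))
    = ∑ j, (G1 j j * e + 2 * κ * (P1 j * ((r1 - r2) * (u1 j - u2 j)))
        - 2 * (P2 j * ((r1 - r2) * (u1 j - u2 j)))
        - 2 * κ * (G2 j j * ((r1 - r2) * (r1 - r2)))
        - 2 * κ * (P2 j * ((r1 - r2) * (u1 j - u2 j)))
        - 2 * κ * ∑ k, G2 k j * ((u1 k - u2 k) * (u1 j - u2 j))) := by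
  have e1 : r1t - r2t = ∑ j, (-(u1 j * P1 j) - κ * r1 * G1 j j + u2 j * P2 j + κ * r2 * G2 j j) := by
    simp only [Finset.sum_add_distrib, Finset.sum_sub_distrib, Finset.sum_neg_distrib,
      ← Finset.mul_sum]
    linarith
  have e2 : ∀ k, u1t k - u2t k = (∑ j, (-(u1 j * G1 k j) + u2 j * G2 k j))
      - r1 * P1 k + r2 * P2 k := by
    intro k
    simp only [Finset.sum_add_distrib, Finset.sum_neg_distrib]
    linarith [h3 k, h4 k]
  have e3 : ∑ k, 2 * (u1 k - u2 k) * (u1t k - u2t k) =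
      ∑ j, ((∑ k, 2 * (u1 k - u2 k) * (-(u1 j * G1 k j) + u2 j * G2 k j))
        + 2 * (u1 j - u2 j) * (- r1 * P1 j + r2 * P2 j)) := by
    rw [Finset.sum_add_distrib, Finset.sum_comm, ← Finset.sum_add_distrib]
    refine Finset.sum_congr rfl fun k _ => ?_
    rw [e2 k, ← Finset.mul_sum]
    ring
  rw [e1, e3, Finset.mul_sum, Finset.mul_sum, ← Finset.sum_add_distrib, ← Finset.sum_add_distrib]
  refine Finset.sum_congr rfl fun j _ => ?_
  have e4 : ∑ k, 2 * (u1 k - u2 k) * (-(u1 j * G1 k j) + u2 j * G2 k j) =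
      - (u1 j * ∑ k, 2 * (u1 k - u2 k) * (G1 k j - G2 k j))
      - 2 * ∑ k, G2 k j * ((u1 k - u2 k) * (u1 j - u2 j)) := by
    rw [Finset.mul_sum, Finset.mul_sum, ← Finset.sum_neg_distrib, ← Finset.sum_sub_distrib]
    exact Finset.sum_congr rfl fun k _ => by ring
  rw [e4]
  ring

/-- Dominated by a multiple of `e` on the time slab. -/
def DomT {n : ℕ} (T : ℝ) (e f : ℝ → (Fin n → ℝ) → ℝ) : Prop :=
  ∃ B : ℝ, 0 ≤ B ∧ ∀ t ∈ Icc (0 : ℝ) T, ∀ x, |f t x| ≤ B * e t x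

namespace DomT
variable {n : ℕ} {T : ℝ} {e f g : ℝ → (Fin n → ℝ) → ℝ}

lemma congr (hf : DomT T e f) (h : ∀ t ∈ Icc (0 : ℝ) T, ∀ x, g t x = f t x) : DomT T e g := by
  obtain ⟨B, hB, hf⟩ := hf
  exact ⟨B, hB, fun t ht x => by rw [h t ht x]; exact hf t ht x⟩

lemma add (hf : DomT T e f) (hg : DomT T e g) : DomT T e (fun t x => f t x + g t x) := by
  obtain ⟨B, hB, hf⟩ := hf
  obtain ⟨B', hB', hg⟩ := hg
  refine ⟨B + B', by positivity, fun t ht x => (abs_add_le _ _).trans ?_⟩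
  linarith [hf t ht x, hg t ht x]

lemma neg (hf : DomT T e f) : DomT T e (fun t x => - f t x) := by
  obtain ⟨B, hB, hf⟩ := hf
  exact ⟨B, hB, fun t ht x => by rw [abs_neg]; exact hf t ht x⟩

lemma sub (hf : DomT T e f) (hg : DomT T e g) : DomT T e (fun t x => f t x - g t x) :=
  (hf.add hg.neg).congr fun _ _ _ => sub_eq_add_neg _ _

lemma mul (hf : DomT T (fun _ _ => 1) f) (hg : DomT T e g) :
    DomT T e (fun t x => f t x * g t x) := by
  obtain ⟨B, hB, hf⟩ := hf
  obtain ⟨B', hB', hg⟩ := hg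
  refine ⟨B * B', by positivity, fun t ht x => ?_⟩
  rw [abs_mul, mul_assoc]
  have h1 := hf t ht x
  rw [mul_one] at h1
  have h2 := hg t ht x
  gcongr

lemma const (c : ℝ) : DomT (n := n) T (fun _ _ => 1) (fun _ _ => c) :=
  ⟨|c|, abs_nonneg _, fun _ _ _ => by simp⟩

lemma const_mul (c : ℝ) (hf : DomT T e f) : DomT T e (fun t x => c * f t x) :=
  (const c).mul hf

lemma sum {m : ℕ} {f : Fin m → ℝ → (Fin n → ℝ) → ℝ}
    (hf : ∀ j, DomT T e (f j)) : DomT T e (fun t x => ∑ j, f j t x) := by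
  choose B hB hf using hf
  refine ⟨∑ j, B j, Finset.sum_nonneg fun j _ => hB j, fun t ht x => ?_⟩
  rw [Finset.sum_mul]
  exact (Finset.abs_sum_le_sum_abs _ _).trans (Finset.sum_le_sum fun j _ => hf j t ht x)

lemma mul_of_sq (hf : DomT T e (fun t x => f t x ^ 2))
    (hg : DomT T e (fun t x => g t x ^ 2)) : DomT T e (fun t x => f t x * g t x) := by
  obtain ⟨B, hB, hf⟩ := hf
  obtain ⟨B', hB', hg⟩ := hg
  refine ⟨B + B', by positivity, fun t ht x => ?_⟩
  have h1 := hf t ht x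
  have h2 := hg t ht x
  rw [abs_of_nonneg (sq_nonneg _)] at h1 h2
  rw [abs_le]
  constructor <;> nlinarith [sq_nonneg (f t x + g t x), sq_nonneg (f t x - g t x),
    sq_nonneg (f t x), sq_nonneg (g t x)]

end DomT

lemma hasDerivAt_energy {n : ℕ} (κ : ℝ) {a b : ℝ → ℝ} {c d : Fin n → ℝ → ℝ} {a' b' τ : ℝ}
    {c' d' : Fin n → ℝ} (ha : HasDerivAt a a' τ) (hb : HasDerivAt b b' τ)
    (hc : ∀ k, HasDerivAt (c k) (c' k) τ) (hd : ∀ k, HasDerivAt (d k) (d' k) τ) :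
    HasDerivAt (fun t => (a t - b t) ^ 2 + κ * ∑ k, (c k t - d k t) ^ 2)
      (2 * (a τ - b τ) * (a' - b') + κ * ∑ k, 2 * (c k τ - d k τ) * (c' k - d' k)) τ := by
  have h1 : HasDerivAt (fun t => (a t - b t) ^ 2) (2 * (a τ - b τ) * (a' - b')) τ := by
    simpa using (ha.fun_sub hb).fun_pow 2
  have h2 : ∀ k, HasDerivAt (fun t => (c k t - d k t) ^ 2)
      (2 * (c k τ - d k τ) * (c' k - d' k)) τ := fun k => by
    simpa using ((hc k).fun_sub (hd k)).fun_pow 2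
  exact h1.fun_add ((HasDerivAt.fun_sum fun k _ => h2 k).const_mul κ)

lemma hasDerivAt_flux {κ : ℝ} {a b c d E : ℝ → ℝ} {a' b' c' d' E' τ : ℝ}
    (ha : HasDerivAt a a' τ) (hb : HasDerivAt b b' τ)
    (hc : HasDerivAt c c' τ) (hd : HasDerivAt d d' τ) (hE : HasDerivAt E E' τ) :
    HasDerivAt (fun t => c t * E t + 2 * κ * (a t * (a t - b t) * (c t - d t)))
      (c' * E τ + c τ * E' + 2 * κ * (a' * (a τ - b τ) * (c τ - d τ)
        + a τ * (a' - b') * (c τ - d τ) + a τ * (a τ - b τ) * (c' - d'))) τ := by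
  have h := (hc.fun_mul hE).fun_add
    (((ha.fun_mul (ha.fun_sub hb)).fun_mul (hc.fun_sub hd)).const_mul (2 * κ))
  exact h.congr_deriv (by ring)

lemma line_deriv {n : ℕ} {f : (Fin n → ℝ) → ℝ} (hf : ContDiff ℝ 1 f) (x v : Fin n → ℝ) :
    HasDerivAt (fun τ : ℝ => f (x + τ • v)) (fderiv ℝ f x v) 0 :=
  ((hf.differentiable (by norm_num) x).hasFDerivAt.hasLineDerivAt v)

/-- Pathwise uniqueness (deterministic core) for the symmetric hyperbolic
reformulation of the barotropic compressible Euler system. -/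
theorem symmetric_hyperbolic_uniqueness (n : ℕ) (hn : 1 ≤ n)
    (γ rbar T : ℝ) (hγ : 1 < γ) (hrbar : 0 < rbar) (hT : 0 < T)
    (r : Fin 2 → ℝ → (Fin n → ℝ) → ℝ) (u : Fin 2 → ℝ → (Fin n → ℝ) → Fin n → ℝ)
    -- continuous differentiability
    (hreg : ∀ i, ContDiff ℝ 1 (Function.uncurry (r i)) ∧
      ContDiff ℝ 1 (Function.uncurry (u i)))
    -- the symmetric hyperbolic system, pointwise on [0,T] × ℝⁿ
    (heq1 : ∀ i, ∀ t ∈ Icc (0 : ℝ) T, ∀ x,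
      deriv (fun s => r i s x) t
        + ∑ j, u i t x j * fderiv ℝ (r i t) x (Pi.single j 1)
        + (γ - 1) / 2 * r i t x *
            ∑ j, fderiv ℝ (fun y => u i t y j) x (Pi.single j 1) = 0)
    (heq2 : ∀ i, ∀ t ∈ Icc (0 : ℝ) T, ∀ x, ∀ k : Fin n,
      deriv (fun s => u i s x k) t
        + ∑ j, u i t x j * fderiv ℝ (fun y => u i t y k) x (Pi.single j 1)
        + r i t x * fderiv ℝ (r i t) x (Pi.single k 1) = 0)
    -- boundedness of the solutions and of their first spatial derivatives
    (hbdd : ∃ C : ℝ, ∀ i, ∀ t ∈ Icc (0 : ℝ) T, ∀ x,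
      |r i t x| ≤ C ∧ ‖u i t x‖ ≤ C ∧
      ‖fderiv ℝ (r i t) x‖ ≤ C ∧ ‖fderiv ℝ (u i t) x‖ ≤ C)
    -- square-integrability in `x` of `r i − r̄`, `u i` and their first spatial derivatives
    (hint : ∀ i, ∀ t ∈ Icc (0 : ℝ) T,
      Integrable (fun x => (r i t x - rbar) ^ 2) ∧
      Integrable (fun x => ‖u i t x‖ ^ 2) ∧
      Integrable (fun x => ‖fderiv ℝ (r i t) x‖ ^ 2) ∧
      Integrable (fun x => ‖fderiv ℝ (u i t) x‖ ^ 2))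
    -- `t ↦ (r i (t,·) − r̄, u i (t,·))` is `C¹` as a map into `L²(ℝⁿ)`
    (hL2 : ∀ i, ∃ (R : ℝ → Lp ℝ 2 (volume : Measure (Fin n → ℝ)))
        (U : ℝ → Lp (Fin n → ℝ) 2 (volume : Measure (Fin n → ℝ))),
      ContDiffOn ℝ 1 R (Icc 0 T) ∧ ContDiffOn ℝ 1 U (Icc 0 T) ∧
      (∀ t ∈ Icc (0 : ℝ) T,
        (R t : (Fin n → ℝ) → ℝ) =ᵐ[volume] fun x => r i t x - rbar) ∧
      (∀ t ∈ Icc (0 : ℝ) T,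
        (U t : (Fin n → ℝ) → Fin n → ℝ) =ᵐ[volume] fun x => u i t x))
    -- the initial data coincide
    (h0 : ∀ x, r 0 0 x = r 1 0 x ∧ u 0 0 x = u 1 0 x) :
    ∀ t ∈ Icc (0 : ℝ) T, ∀ x, r 0 t x = r 1 t x ∧ u 0 t x = u 1 t x := by
  obtain ⟨C, hC⟩ := hbdd
  set κ : ℝ := (γ - 1) / 2 with hκd
  have hκ : 0 < κ := by rw [hκd]; linarith
  -- regularity in space
  have hrx : ∀ i t, ContDiff ℝ 1 (r i t) := fun i t =>
    (hreg i).1.comp (f := fun x : Fin n → ℝ => (t, x)) (by fun_prop)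
  have hux : ∀ i t, ContDiff ℝ 1 (u i t) := fun i t =>
    (hreg i).2.comp (f := fun x : Fin n → ℝ => (t, x)) (by fun_prop)
  have hukx : ∀ i t k, ContDiff ℝ 1 (fun y => u i t y k) := fun i t k =>
    contDiff_pi.1 (hux i t) k
  have huk : ∀ i k, ContDiff ℝ 1 (fun p : ℝ × (Fin n → ℝ) => u i p.1 p.2 k) := fun i k =>
    contDiff_pi.1 (hreg i).2 k
  have hrr : ∀ i, ContDiff ℝ 1 (fun p : ℝ × (Fin n → ℝ) => r i p.1 p.2) := fun i => (hreg i).1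
  -- derivatives in time
  have hrt : ∀ i t x, HasDerivAt (fun s => r i s x) (deriv (fun s => r i s x) t) t := by
    intro i t x
    have h : ContDiff ℝ 1 (fun s => r i s x) :=
      (hrr i).comp (f := fun s : ℝ => (s, x)) (by fun_prop)
    exact (h.differentiable (by norm_num) t).hasDerivAt
  have hut : ∀ i t x k, HasDerivAt (fun s => u i s x k) (deriv (fun s => u i s x k) t) t := by
    intro i t x k
    have h : ContDiff ℝ 1 (fun s => u i s x k) :=
      (huk i k).comp (f := fun s : ℝ => (s, x)) (by fun_prop)
    exact (h.differentiable (by norm_num) t).hasDerivAt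
  -- bounds
  have hsing : ∀ j : Fin n, ‖(Pi.single j 1 : Fin n → ℝ)‖ = 1 := fun j => by rw [Pi.norm_single, norm_one]
  have bdd : ∀ f : ℝ → (Fin n → ℝ) → ℝ, (∀ t ∈ Icc (0 : ℝ) T, ∀ x, |f t x| ≤ C) →
      DomT T (fun _ _ => 1) f := fun f hf =>
    ⟨|C|, abs_nonneg _, fun t ht x => by rw [mul_one]; exact (hf t ht x).trans (le_abs_self _)⟩
  have br : ∀ i, DomT T (fun _ _ => 1) (r i) := fun i => bdd _ fun t ht x => (hC i t ht x).1
  have bu : ∀ i k, DomT T (fun _ _ => 1) (fun t x => u i t x k) := fun i k =>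
    bdd _ fun t ht x => (norm_le_pi_norm (u i t x) k).trans (hC i t ht x).2.1
  have bP : ∀ i j, DomT T (fun _ _ => 1) (fun t x => fderiv ℝ (r i t) x (Pi.single j 1)) :=
    fun i j => bdd _ fun t ht x => by
      have h := (fderiv ℝ (r i t) x).le_opNorm (Pi.single j 1)
      rw [hsing, mul_one] at h
      exact h.trans (hC i t ht x).2.2.1
  have bG : ∀ i k j, DomT T (fun _ _ => 1)
      (fun t x => fderiv ℝ (fun y => u i t y k) x (Pi.single j 1)) :=
    fun i k j => bdd _ fun t ht x => by
      have h := (fderiv ℝ (u i t) x).le_opNorm (Pi.single j 1)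
      rw [hsing, mul_one] at h
      have h1 : HasFDerivAt (fun y => u i t y k)
          ((ContinuousLinearMap.proj k).comp (fderiv ℝ (u i t) x)) x :=
        hasFDerivAt_pi'.1 ((hux i t).differentiable (by norm_num) x).hasFDerivAt k
      rw [h1.fderiv]
      exact (norm_le_pi_norm (fderiv ℝ (u i t) x (Pi.single j 1)) k).trans
        (h.trans (hC i t ht x).2.2.2)
  have brt : ∀ i, DomT T (fun _ _ => 1) (fun t x => deriv (fun s => r i s x) t) := fun i =>
    DomT.congr (((DomT.sum fun j => (bu i j).mul (bP i j)).add
      (((br i).const_mul κ).mul (DomT.sum fun j => bG i j j))).neg) fun t ht x => by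
        linarith [heq1 i t ht x]
  have but : ∀ i k, DomT T (fun _ _ => 1) (fun t x => deriv (fun s => u i s x k) t) := fun i k =>
    DomT.congr (((DomT.sum fun j => (bu i j).mul (bG i k j)).add
      ((br i).mul (bP i k))).neg) fun t ht x => by
        linarith [heq2 i t ht x k]
  -- the energy density and its flux
  let e : ℝ → (Fin n → ℝ) → ℝ := fun t x =>
    (r 0 t x - r 1 t x) ^ 2 + κ * ∑ k, (u 0 t x k - u 1 t x k) ^ 2
  let F : Fin n → ℝ → (Fin n → ℝ) → ℝ := fun j t x =>
    u 0 t x j * e t x + 2 * κ * (r 0 t x * (r 0 t x - r 1 t x) * (u 0 t x j - u 1 t x j))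
  have hsum0 : ∀ t x, 0 ≤ ∑ k, (u 0 t x k - u 1 t x k) ^ 2 := fun t x =>
    Finset.sum_nonneg fun k _ => sq_nonneg _
  have hepos : ∀ t x, 0 ≤ e t x := fun t x => by
    have := hsum0 t x
    simp only [e]; positivity
  have hecd : ContDiff ℝ 1 (Function.uncurry e) := by
    have h0 := hrr 0
    have h1 := hrr 1
    have h2 := huk 0
    have h3 := huk 1
    change ContDiff ℝ 1 (fun p : ℝ × (Fin n → ℝ) =>
      (r 0 p.1 p.2 - r 1 p.1 p.2) ^ 2 + κ * ∑ k, (u 0 p.1 p.2 k - u 1 p.1 p.2 k) ^ 2)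
    exact ((h0.sub h1).pow 2).add (contDiff_const.mul
      (ContDiff.sum fun k _ => ((h2 k).sub (h3 k)).pow 2))
  have hex : ∀ t, ContDiff ℝ 1 (e t) := fun t =>
    hecd.comp (f := fun x : Fin n → ℝ => (t, x)) (by fun_prop)
  have hFx : ∀ j t, ContDiff ℝ 1 (F j t) := fun j t =>
    ((hukx 0 t j).mul (hex t)).add (contDiff_const.mul
      (((hrx 0 t).mul ((hrx 0 t).sub (hrx 1 t))).mul ((hukx 0 t j).sub (hukx 1 t j))))
  have het : ∀ t x, deriv (fun s => e s x) t = _ := fun t x =>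
    (hasDerivAt_energy κ (hrt 0 t x) (hrt 1 t x) (hut 0 t x) (hut 1 t x)).deriv
  have hFD : ∀ j t x, fderiv ℝ (F j t) x (Pi.single j 1) =
      fderiv ℝ (fun y => u 0 t y j) x (Pi.single j 1) * e t x
      + u 0 t x j * (2 * (r 0 t x - r 1 t x) *
          (fderiv ℝ (r 0 t) x (Pi.single j 1) - fderiv ℝ (r 1 t) x (Pi.single j 1))
        + κ * ∑ k, 2 * (u 0 t x k - u 1 t x k) *
          (fderiv ℝ (fun y => u 0 t y k) x (Pi.single j 1)
            - fderiv ℝ (fun y => u 1 t y k) x (Pi.single j 1)))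
      + 2 * κ * (fderiv ℝ (r 0 t) x (Pi.single j 1) * (r 0 t x - r 1 t x)
          * (u 0 t x j - u 1 t x j)
        + r 0 t x * (fderiv ℝ (r 0 t) x (Pi.single j 1) - fderiv ℝ (r 1 t) x (Pi.single j 1))
          * (u 0 t x j - u 1 t x j)
        + r 0 t x * (r 0 t x - r 1 t x) * (fderiv ℝ (fun y => u 0 t y j) x (Pi.single j 1)
            - fderiv ℝ (fun y => u 1 t y j) x (Pi.single j 1))) := by
    intro j t x
    have hr0 := line_deriv (hrx 0 t) x (Pi.single j 1)
    have hr1 := line_deriv (hrx 1 t) x (Pi.single j 1)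
    have hu0 := fun k => line_deriv (hukx 0 t k) x (Pi.single j 1)
    have hu1 := fun k => line_deriv (hukx 1 t k) x (Pi.single j 1)
    have hE := hasDerivAt_energy κ hr0 hr1 hu0 hu1
    have hF := hasDerivAt_flux (κ := κ) hr0 hr1 (hu0 j) (hu1 j) hE
    have h := (line_deriv (hFx j t) x (Pi.single j 1)).unique hF
    rw [h]
    simp only [zero_smul, add_zero]
    rfl
  -- bounds of the energy quantities
  have bs : DomT T (fun _ _ => 1) (fun t x => r 0 t x - r 1 t x) := (br 0).sub (br 1)
  have bw : ∀ k, DomT T (fun _ _ => 1) (fun t x => u 0 t x k - u 1 t x k) := fun k =>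
    (bu 0 k).sub (bu 1 k)
  have be : DomT T (fun _ _ => 1) e :=
    DomT.congr ((bs.mul bs).add ((DomT.sum fun k => (bw k).mul (bw k)).const_mul κ))
      fun t _ x => by simp only [e, pow_two]
  have bet : DomT T (fun _ _ => 1) (fun t x => deriv (fun s => e s x) t) :=
    DomT.congr (((bs.const_mul 2).mul ((brt 0).sub (brt 1))).add
      ((DomT.sum fun k => ((bw k).const_mul 2).mul ((but 0 k).sub (but 1 k))).const_mul κ))
      fun t _ x => het t x
  have bFD : ∀ j, DomT T (fun _ _ => 1) (fun t x => fderiv ℝ (F j t) x (Pi.single j 1)) :=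
    fun j => DomT.congr ((((bG 0 j j).mul be).add ((bu 0 j).mul
      (((bs.const_mul 2).mul ((bP 0 j).sub (bP 1 j))).add
        ((DomT.sum fun k => ((bw k).const_mul 2).mul ((bG 0 k j).sub (bG 1 k j))).const_mul κ)))).add
      ((((((bP 0 j).mul bs).mul (bw j)).add (((br 0).mul ((bP 0 j).sub (bP 1 j))).mul (bw j))).add
        (((br 0).mul bs).mul ((bG 0 j j).sub (bG 1 j j)))).const_mul (2 * κ)))
      fun t _ x => hFD j t x
  -- quantities dominated by the energy
  have de : DomT T e e := ⟨1, zero_le_one, fun t _ x => by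
    rw [one_mul, abs_of_nonneg (hepos t x)]⟩
  have ds : DomT T e (fun t x => (r 0 t x - r 1 t x) ^ 2) := ⟨1, zero_le_one, fun t _ x => by
    rw [one_mul, abs_of_nonneg (sq_nonneg _)]
    have := mul_nonneg hκ.le (hsum0 t x)
    simp only [e]; linarith⟩
  have dw : ∀ k, DomT T e (fun t x => (u 0 t x k - u 1 t x k) ^ 2) := fun k =>
    ⟨κ⁻¹, by positivity, fun t _ x => by
      rw [abs_of_nonneg (sq_nonneg _), inv_mul_eq_div, le_div_iff₀ hκ, mul_comm]
      have h1 : (u 0 t x k - u 1 t x k) ^ 2 ≤ ∑ k, (u 0 t x k - u 1 t x k) ^ 2 :=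
        Finset.single_le_sum (f := fun k => (u 0 t x k - u 1 t x k) ^ 2)
          (fun i _ => sq_nonneg _) (Finset.mem_univ k)
      have h2 := mul_le_mul_of_nonneg_left h1 hκ.le
      have h3 := sq_nonneg (r 0 t x - r 1 t x)
      simp only [e]; linarith⟩
  have dsw : ∀ k, DomT T e (fun t x => (r 0 t x - r 1 t x) * (u 0 t x k - u 1 t x k)) := fun k =>
    DomT.mul_of_sq ds (dw k)
  have dss : DomT T e (fun t x => (r 0 t x - r 1 t x) * (r 0 t x - r 1 t x)) :=
    DomT.mul_of_sq ds ds
  have dww : ∀ k j, DomT T e (fun t x => (u 0 t x k - u 1 t x k) * (u 0 t x j - u 1 t x j)) :=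
    fun k j => DomT.mul_of_sq (dw k) (dw j)
  have dF : ∀ j, DomT T e (F j) := fun j =>
    DomT.congr (((bu 0 j).mul de).add (((br 0).mul (dsw j)).const_mul (2 * κ)))
      fun t _ x => by simp only [F]; ring
  have dQ : DomT T e (fun t x => deriv (fun s => e s x) t
      + ∑ j, fderiv ℝ (F j t) x (Pi.single j 1)) := by
    refine DomT.congr (DomT.sum fun j => ((((((bG 0 j j).mul de).add
      (((bP 0 j).mul (dsw j)).const_mul (2 * κ))).sub (((bP 1 j).mul (dsw j)).const_mul 2)).sub
      (((bG 1 j j).mul dss).const_mul (2 * κ))).sub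
      (((bP 1 j).mul (dsw j)).const_mul (2 * κ))).sub
      ((DomT.sum fun k => (bG 1 k j).mul (dww k j)).const_mul (2 * κ))) fun t ht x => ?_
    rw [het t x, Finset.sum_congr rfl fun j _ => hFD j t x]
    exact energy_algebra κ (r 0 t x) (r 1 t x) _ _ (u 0 t x) (u 1 t x) _ _ _ _
      (fun k j => fderiv ℝ (fun y => u 0 t y k) x (Pi.single j 1))
      (fun k j => fderiv ℝ (fun y => u 1 t y k) x (Pi.single j 1))
      (heq1 0 t ht x) (heq1 1 t ht x) (heq2 0 t ht x) (heq2 1 t ht x) (e t x)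
  obtain ⟨B1, hB1, be⟩ := be
  obtain ⟨B2, hB2, bet⟩ := bet
  obtain ⟨K, hK, dQ⟩ := dQ
  choose L hL dF using dF
  have hzero := energy_zero hn (T := T) e F hecd hFx hepos (B1 + B2) K (∑ j, L j)
    (Finset.sum_nonneg fun j _ => hL j)
    (fun t ht x => by linarith [be t ht x]) (fun t ht x => by linarith [bet t ht x])
    (fun j => by
      obtain ⟨B', _, h⟩ := bFD j
      exact ⟨B', fun t ht x => by linarith [h t ht x]⟩)
    (fun t ht x => (le_abs_self _).trans (dQ t ht x))
    (fun j t ht x => (dF j t ht x).trans (mul_le_mul_of_nonneg_right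
      (Finset.single_le_sum (fun i _ => hL i) (Finset.mem_univ j)) (hepos t x)))
    (fun x => by simp [e, (h0 x).1, (h0 x).2])
  intro t ht x
  have hz : (r 0 t x - r 1 t x) ^ 2 + κ * ∑ k, (u 0 t x k - u 1 t x k) ^ 2 = 0 := hzero t ht x
  have h1 := mul_nonneg hκ.le (hsum0 t x)
  have h2 := sq_nonneg (r 0 t x - r 1 t x)
  have h3 : (r 0 t x - r 1 t x) ^ 2 = 0 := by linarith
  have h4 : κ * ∑ k, (u 0 t x k - u 1 t x k) ^ 2 = 0 := by linarith
  have h5 : ∑ k, (u 0 t x k - u 1 t x k) ^ 2 = 0 := (mul_eq_zero.1 h4).resolve_left hκ.ne'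
  refine ⟨sub_eq_zero.1 (pow_eq_zero_iff (two_ne_zero) |>.1 h3), funext fun k => ?_⟩
  have h6 := (Finset.sum_eq_zero_iff_of_nonneg fun k _ => sq_nonneg _).1 h5 k (Finset.mem_univ k)
  exact sub_eq_zero.1 (pow_eq_zero_iff (two_ne_zero) |>.1 h6)
end
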